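/- arXiv:1210.6747 — 3 statements merged into one kernel-verified Lean document; each statement's English description precedes it below -/
import Mathlib

section
/- Let n ≥ 1 and let X = ℝ^n be the Euclidean space, i.e. Fin n → ℝ with the sup-metric. A subset A ⊆ X is small if and only if A has asymptotic dimension at most n − 1. -/
open Metric Set

/-- A subset `L` of a metric space is *large* if some `r`-neighborhood of `L` is the whole space. -/
def IsLarge {X : Type*} [MetricSpace X] (L : Set X) : Prop :=
  ∃ r > (0 : ℝ), ∀ x : X, ∃ y ∈ L, dist x y < r

/-- A subset `A` of a metric space is *small* if for every large set `L` the set `L \\ A` is large. -/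
def IsSmall {X : Type*} [MetricSpace X] (A : Set X) : Prop :=
  ∀ L : Set X, IsLarge L → IsLarge (L \ A)

/-- `AsdimLE X n` means the asymptotic dimension of `X` is at most `n`: for every `r > 0`
there are `D > 0` and a cover of `X` by sets of diameter at most `D` such that every open
`r`-ball meets at most `n + 1` members of the cover. -/
def AsdimLE (X : Type*) [MetricSpace X] (n : ℕ) : Prop :=
  ∀ r > (0 : ℝ), ∃ D > (0 : ℝ), ∃ U : Set (Set X),
    ⋃₀ U = univ ∧
    (∀ u ∈ U, EMetric.diam u ≤ ENNReal.ofReal D) ∧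
    ∀ x : X, {u ∈ U | (u ∩ Metric.ball x r).Nonempty}.Finite ∧
      {u ∈ U | (u ∩ Metric.ball x r).Nonempty}.ncard ≤ n + 1

/-- A map between metric spaces is *coarse* if it maps pairs at bounded distance to
pairs at bounded distance. -/
def IsCoarseMap {X Y : Type*} [MetricSpace X] [MetricSpace Y] (f : X → Y) : Prop :=
  ∀ R > (0 : ℝ), ∃ S > (0 : ℝ), ∀ x x' : X, dist x x' ≤ R → dist (f x) (f x') ≤ S

/-- A coarse map `f : X → Y` is a *coarse equivalence* if it has a coarse inverse up to
uniformly bounded distance. -/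
def IsCoarseEquiv {X Y : Type*} [MetricSpace X] [MetricSpace Y] (f : X → Y) : Prop :=
  IsCoarseMap f ∧ ∃ g : Y → X, IsCoarseMap g ∧
    (∃ C : ℝ, ∀ x : X, dist x (g (f x)) ≤ C) ∧
    (∃ C : ℝ, ∀ y : Y, dist y (f (g y)) ≤ C)

/-! ### A Sperner-type lemma on the Freudenthal triangulation -/

namespace KuhnSperner

/-- The steps of the cyclic walk around a Freudenthal simplex. -/
def stepv {n : ℕ} (a : Fin (n+1)) : Fin n → ℤ :=
  fun b => if a = Fin.last n then -1 else if a = b.castSucc then 1 else 0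

abbrev Pre (n : ℕ) := (Fin (n+1) → Fin n → ℤ) × Equiv.Perm (Fin (n+1))

def IsFlag {n : ℕ} (f : Pre n) : Prop := ∀ j, f.1 (j+1) = f.1 j + stepv (f.2 j)

def rot {n : ℕ} (k : Fin (n+1)) (f : Pre n) : Pre n :=
  (fun j => f.1 (j+k), (Equiv.addRight k).trans f.2)

def flip {n : ℕ} (f : Pre n) : Pre n :=
  (Function.update f.1 0 (f.1 1 + f.1 (-1) - f.1 0), (Equiv.swap 0 (-1)).trans f.2)

lemma IsFlag.rot {n : ℕ} {f : Pre n} (h : IsFlag f) (k : Fin (n+1)) : IsFlag (rot k f) := by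
  intro j
  have := h (j + k)
  simp only [KuhnSperner.rot, Equiv.trans_apply, Equiv.coe_addRight]
  rw [← this, add_right_comm]

lemma one_ne {n : ℕ} (hn : 1 ≤ n) : (1 : Fin (n+1)) ≠ 0 := by
  obtain ⟨m, rfl⟩ : ∃ m, n = m + 1 := ⟨n - 1, by omega⟩
  exact one_ne_zero

lemma IsFlag.flip {n : ℕ} (hn : 1 ≤ n) {f : Pre n} (h : IsFlag f) : IsFlag (flip f) := by
  have h1 := one_ne hn
  have h2 : (-1 : Fin (n+1)) ≠ 0 := neg_ne_zero.mpr h1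
  intro j
  simp only [KuhnSperner.flip, Equiv.trans_apply]
  by_cases hj0 : j = 0
  · subst hj0
    have := h (-1)
    simp only [neg_add_cancel] at this
    simp [h1, Function.update_of_ne, this]
    abel
  · by_cases hj1 : j = -1
    · subst hj1
      have := h 0
      simp only [zero_add] at this
      simp [h2, Function.update_of_ne, this]
      abel
    · have h3 : j + 1 ≠ 0 := fun h => hj1 (eq_neg_of_add_eq_zero_left h)
      rw [Function.update_of_ne h3, Function.update_of_ne hj0,
        Equiv.swap_apply_of_ne_of_ne hj0 hj1, h j]

lemma flip_flip {n : ℕ} (hn : 1 ≤ n) (f : Pre n) : flip (flip f) = f := by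
  have h1 := one_ne hn
  have h2 : (-1 : Fin (n+1)) ≠ 0 := neg_ne_zero.mpr h1
  refine Prod.ext ?_ ?_
  · simp [flip, h1, h2]
  · ext j
    simp [flip]

lemma flip_ne {n : ℕ} (hn : 1 ≤ n) (f : Pre n) : flip f ≠ f := by
  have h1 := one_ne hn
  intro h
  have h2 := congrArg (fun g : Pre n => g.2 0) h
  simp [flip, h1] at h2

lemma rot_ne {n : ℕ} {k : Fin (n+1)} (hk : k ≠ 0) (f : Pre n) : rot k f ≠ f := by
  intro h
  have h2 := congrArg (fun g : Pre n => g.2 0) h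
  simp [rot, hk] at h2

lemma rot_rot {n : ℕ} (k : Fin (n+1)) (f : Pre n) : rot (-k) (rot k f) = f := by
  refine Prod.ext ?_ ?_
  · funext j; simp [rot]
  · ext j; simp [rot]

lemma normal {n : ℕ} {f : Pre n} (h : IsFlag f) (hl : f.2 (Fin.last n) = Fin.last n)
    (j : Fin (n+1)) (a : Fin n) :
    f.1 j a = f.1 0 a + if f.2.symm a.castSucc < j then 1 else 0 := by
  induction j using Fin.induction with
  | zero => simp
  | succ j ih =>
    have h1 := congrFun (h j.castSucc) a
    rw [Fin.coeSucc_eq_succ] at h1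
    have h2 : f.2 j.castSucc ≠ Fin.last n := by
      intro h
      exact (Fin.castSucc_lt_last j).ne (f.2.injective (h.trans hl.symm))
    rw [h1, Pi.add_apply, ih]
    simp only [stepv, h2, if_false]
    by_cases h3 : f.2 j.castSucc = a.castSucc
    · have : f.2.symm a.castSucc = j.castSucc := by rw [← h3]; simp
      simp [this, h3]
    · have h4 : f.2.symm a.castSucc ≠ j.castSucc := by
        intro h; apply h3; rw [← h]; simp
      have : f.2.symm a.castSucc < j.castSucc ↔ f.2.symm a.castSucc < j.succ := by
        rw [Fin.lt_def, Fin.lt_def]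
        have : (f.2.symm a.castSucc).val ≠ j.val := fun h => h4 (Fin.ext h)
        simp; omega
      simp [this, h3]

lemma exists_rot {n : ℕ} {f : Pre n} (h : IsFlag f) :
    ∃ k, IsFlag (rot k f) ∧ (rot k f).2 (Fin.last n) = Fin.last n := by
  refine ⟨f.2.symm (Fin.last n) - Fin.last n, h.rot _, ?_⟩
  simp [rot]

lemma width {n : ℕ} {f : Pre n} (h : IsFlag f) (i j : Fin (n+1)) (a : Fin n) :
    f.1 i a ≤ f.1 j a + 1 := by
  obtain ⟨k, hk, hl⟩ := exists_rot h
  have h1 := normal hk hl (i - k) a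
  have h2 := normal hk hl (j - k) a
  simp only [rot, sub_add_cancel] at h1 h2
  rw [h1, h2]
  split_ifs <;> omega

/-! #### Doors and rainbow simplices -/

def door {n : ℕ} (c : (Fin n → ℤ) → Fin (n+1)) (f : Pre n) : Prop :=
  ∀ i : Fin n, ∃ j, j ≠ 0 ∧ c (f.1 j) = i.castSucc

def rb {n : ℕ} (c : (Fin n → ℤ) → Fin (n+1)) (f : Pre n) : Prop :=
  door c f ∧ c (f.1 0) = Fin.last n

lemma door_inj {n : ℕ} {c : (Fin n → ℤ) → Fin (n+1)} {f : Pre n} (h : door c f) :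
    (∀ j, j ≠ 0 → c (f.1 j) ≠ Fin.last n) ∧
    ∀ j j', j ≠ 0 → j' ≠ 0 → c (f.1 j) = c (f.1 j') → j = j' := by
  have h' : ∀ i : Fin n, ∃ j : Fin n, c (f.1 j.succ) = i.castSucc := by
    intro i
    obtain ⟨j, hj, hc⟩ := h i
    obtain ⟨k, rfl⟩ := Fin.exists_succ_eq.mpr hj
    exact ⟨k, hc⟩
  choose s hs using h'
  have hinj : Function.Injective s := by
    intro a b hab
    have := hs a
    rw [hab, hs b] at this
    exact (Fin.castSucc_injective _ this).symm
  have hsurj := Finite.surjective_of_injective hinj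
  constructor
  · intro j hj
    obtain ⟨k, rfl⟩ := Fin.exists_succ_eq.mpr hj
    obtain ⟨i, rfl⟩ := hsurj k
    rw [hs]
    exact (Fin.castSucc_lt_last i).ne
  · intro j j' hj hj' he
    obtain ⟨k, rfl⟩ := Fin.exists_succ_eq.mpr hj
    obtain ⟨i, rfl⟩ := hsurj k
    obtain ⟨k', rfl⟩ := Fin.exists_succ_eq.mpr hj'
    obtain ⟨i', rfl⟩ := hsurj k'
    rw [hs, hs] at he
    rw [Fin.castSucc_injective _ he]

open Classical in
lemma even_of_invol {α : Type*} (s : Finset α) (g : ∀ a ∈ s, α)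
    (h3 : ∀ a ha, g a ha ≠ a) (hm : ∀ a ha, g a ha ∈ s)
    (h4 : ∀ a ha, g (g a ha) (hm a ha) = a) : (s.card : ZMod 2) = 0 := by
  have := Finset.sum_involution (s := s) (f := fun _ => (1 : ZMod 2)) g
    (fun _ _ => by decide) (fun a ha _ => h3 a ha) hm h4
  simpa using this

open Classical in
lemma parity_rot {n : ℕ} (c : (Fin n → ℤ) → Fin (n+1)) (F : Finset (Pre n))
    (hF : ∀ f ∈ F, ∀ k, rot k f ∈ F) :
    ((F.filter (door c)).card : ZMod 2) = ((F.filter (rb c)).card : ZMod 2) := by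
  have key : (((F.filter (door c)).filter (fun f => ¬ c (f.1 0) = Fin.last n)).card : ZMod 2)
      = 0 := by
    have hex : ∀ f ∈ (F.filter (door c)).filter (fun f => ¬ c (f.1 0) = Fin.last n),
        ∃ j, j ≠ 0 ∧ c (f.1 j) = c (f.1 0) := by
      intro f hf
      simp only [Finset.mem_filter] at hf
      obtain ⟨i, hi⟩ := Fin.exists_castSucc_eq.mpr hf.2
      obtain ⟨j, hj, hc⟩ := hf.1.2 i
      exact ⟨j, hj, hc.trans hi⟩
    choose g hg0 hg using hex
    have hm : ∀ f (hf : f ∈ (F.filter (door c)).filter (fun f => ¬ c (f.1 0) = Fin.last n)),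
        rot (g f hf) f ∈ (F.filter (door c)).filter (fun f => ¬ c (f.1 0) = Fin.last n) := by
      intro f hf
      have hf' := hf
      simp only [Finset.mem_filter] at hf' ⊢
      refine ⟨⟨hF f hf'.1.1 _, ?_⟩, ?_⟩
      · intro i
        obtain ⟨j, hj, hc⟩ := hf'.1.2 i
        by_cases hjg : j = g f hf
        · refine ⟨- g f hf, neg_ne_zero.mpr (hg0 f hf), ?_⟩
          simp only [rot, neg_add_cancel]
          rw [← hg f hf, ← hjg, hc]
        · refine ⟨j - g f hf, sub_ne_zero.mpr hjg, ?_⟩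
          simpa [rot] using hc
      · simp only [rot, zero_add]
        rw [hg f hf]; exact hf'.2
    refine even_of_invol _ (fun f hf => rot (g f hf) f) (fun f hf => rot_ne (hg0 f hf) f) hm ?_
    intro f hf
    have h1 := hg0 _ (hm f hf)
    have h2 := hg _ (hm f hf)
    have hd := (Finset.mem_filter.mp (Finset.mem_filter.mp (hm f hf)).1).2
    have : g _ (hm f hf) = - g f hf := by
      apply (door_inj hd).2 _ _ h1 (neg_ne_zero.mpr (hg0 f hf))
      rw [h2]
      simp only [rot, zero_add, neg_add_cancel]
      exact hg f hf
    simp only [this]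
    exact rot_rot _ _
  have hsplit := Finset.card_filter_add_card_filter_not (s := F.filter (door c))
    (fun f => c (f.1 0) = Fin.last n)
  rw [← hsplit, Nat.cast_add, key, add_zero, Finset.filter_filter]
  congr 2
  ext f
  simp [rb]

open Classical in
lemma parity_flip {n : ℕ} (hn : 1 ≤ n) (c c' : (Fin n → ℤ) → Fin (n+1)) (B : Set (Fin n → ℤ))
    (hcc : ∀ v, v ∉ B → c v = c' v) (F : Finset (Pre n))
    (hF : ∀ f, f ∈ F ↔ IsFlag f ∧ ∃ j, f.1 j ∈ B) :
    ((F.filter (door c)).card : ZMod 2) = ((F.filter (door c')).card : ZMod 2) := by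
  have key : ∀ d : (Fin n → ℤ) → Fin (n+1),
      (((F.filter (door d)).filter (fun f => ∃ j, j ≠ 0 ∧ f.1 j ∈ B)).card : ZMod 2) = 0 := by
    intro d
    have hfl : ∀ (f : Pre n) j, j ≠ 0 → (flip f).1 j = f.1 j := by
      intro f j hj
      simp [flip, hj]
    refine even_of_invol _ (fun f _ => flip f) (fun f _ => flip_ne hn f) ?_
      (fun f _ => flip_flip hn f)
    intro f hf
    simp only [Finset.mem_filter, hF] at hf ⊢
    obtain ⟨⟨⟨h1, -⟩, h2⟩, j, hj, hB⟩ := hf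
    refine ⟨⟨⟨h1.flip hn, j, by rwa [hfl f j hj]⟩, ?_⟩, j, hj, by rwa [hfl f j hj]⟩
    intro i
    obtain ⟨k, hk, hc⟩ := h2 i
    exact ⟨k, hk, by rw [hfl f k hk, hc]⟩
  have h1 := Finset.card_filter_add_card_filter_not (s := F.filter (door c))
    (fun f => ∃ j, j ≠ 0 ∧ f.1 j ∈ B)
  have h2 := Finset.card_filter_add_card_filter_not (s := F.filter (door c'))
    (fun f => ∃ j, j ≠ 0 ∧ f.1 j ∈ B)
  rw [← h1, ← h2, Nat.cast_add, Nat.cast_add, key, key]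
  congr 3
  ext f
  simp only [Finset.mem_filter]
  constructor
  · rintro ⟨⟨hf, hd⟩, hB⟩
    push Not at hB
    refine ⟨⟨hf, fun i => ?_⟩, by push Not; exact hB⟩
    obtain ⟨j, hj, hc⟩ := hd i
    exact ⟨j, hj, by rw [← hcc _ (hB j hj), hc]⟩
  · rintro ⟨⟨hf, hd⟩, hB⟩
    push Not at hB
    refine ⟨⟨hf, fun i => ?_⟩, by push Not; exact hB⟩
    obtain ⟨j, hj, hc⟩ := hd i
    exact ⟨j, hj, by rw [hcc _ (hB j hj), hc]⟩

/-! #### The standard labelling -/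

lemma exists_lab {n : ℕ} (q : Fin n → ℤ) : ∃ l : Fin (n+1),
    (∀ k : Fin n, k.castSucc < l → 0 ≤ q k) ∧ (∀ k : Fin n, l = k.castSucc → q k < 0) := by
  by_cases h : ∃ k : Fin n, q k < 0
  · obtain ⟨k, hk, hmin⟩ := WellFounded.has_min (wellFounded_lt (α := Fin n)) {k | q k < 0} h
    refine ⟨k.castSucc, fun i hi => ?_, fun i hi => ?_⟩
    · by_contra hneg
      exact hmin i (by simpa using hneg) (by simpa using hi)
    · rw [← Fin.castSucc_injective _ hi]; exact hk
  · push Not at h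
    refine ⟨Fin.last n, fun k _ => h k, fun k hk => ?_⟩
    exact absurd hk (Fin.castSucc_lt_last k).ne'

noncomputable def lab {n : ℕ} (q : Fin n → ℤ) : Fin (n+1) := (exists_lab q).choose

lemma lab_nonneg {n : ℕ} (q : Fin n → ℤ) {k : Fin n} (h : k.castSucc < lab q) : 0 ≤ q k :=
  (exists_lab q).choose_spec.1 k h

lemma lab_neg {n : ℕ} (q : Fin n → ℤ) {k : Fin n} (h : lab q = k.castSucc) : q k < 0 :=
  (exists_lab q).choose_spec.2 k h

lemma lab_last {n : ℕ} (q : Fin n → ℤ) (h : lab q = Fin.last n) (k : Fin n) : 0 ≤ q k :=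
  lab_nonneg q (h ▸ Fin.castSucc_lt_last k)

lemma lab_eq {n : ℕ} (q : Fin n → ℤ) (l : Fin (n+1))
    (h1 : ∀ k : Fin n, k.castSucc < l → 0 ≤ q k) (h2 : ∀ k : Fin n, l = k.castSucc → q k < 0) :
    lab q = l := by
  rcases lt_trichotomy (lab q) l with h | h | h
  · obtain ⟨k, hk⟩ := Fin.exists_castSucc_eq.mpr (h.trans_le (Fin.le_last l)).ne
    have := lab_neg q hk.symm
    have := h1 k (hk ▸ h)
    omega
  · exact h
  · obtain ⟨k, hk⟩ := Fin.exists_castSucc_eq.mpr (h.trans_le (Fin.le_last _)).ne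
    have := lab_nonneg q (hk ▸ h)
    have := h2 k hk.symm
    omega

lemma lab_mono {n : ℕ} {q q' : Fin n → ℤ} (h : q ≤ q') : lab q ≤ lab q' := by
  by_contra hlt
  push Not at hlt
  obtain ⟨k, hk⟩ := Fin.exists_castSucc_eq.mpr (hlt.trans_le (Fin.le_last _)).ne
  have h1 := lab_nonneg q (hk ▸ hlt)
  have h2 := lab_neg q' hk.symm
  have h3 : q k ≤ q' k := h k
  omega

/-- The unique rainbow simplex of the standard labelling. -/
def std (n : ℕ) : Pre n :=
  (fun j a => if j.val = 0 ∨ a.val + 1 < j.val then 0 else -1, Equiv.subRight 1)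

lemma std_flag {n : ℕ} (hn : 1 ≤ n) : IsFlag (std n) := by
  intro j
  funext a
  simp only [std, Equiv.subRight_apply, Pi.add_apply, stepv]
  have ha := a.2
  have hj := j.2
  have e1 := Fin.val_add_one j
  have e2 := Fin.coe_sub_one j
  simp only [Fin.ext_iff, Fin.val_last, Fin.val_castSucc, Fin.val_zero] at *
  rw [e1, e2]
  clear e1 e2
  by_cases c1 : j.val = n
  · have c2 : j.val ≠ 0 := by omega
    simp only [c1, if_true, true_or]
    split_ifs <;> omega
  · by_cases c2 : j.val = 0
    · simp only [c2, true_or, if_true]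
      split_ifs <;> first | omega | (simp_all; done) | (simp_all; omega)
    · simp only [c1, c2, if_false, false_or]
      split_ifs <;> first | omega | (simp_all; done) | (simp_all; omega)

lemma stepv_inj {n : ℕ} : Function.Injective (stepv (n := n)) := by
  intro a b h
  rcases Fin.eq_castSucc_or_eq_last a with ⟨i, rfl⟩ | rfl
  · have := congrFun h i
    simp only [stepv] at this
    split_ifs at this <;> simp_all
  · rcases Fin.eq_castSucc_or_eq_last b with ⟨i, rfl⟩ | rfl
    · have := congrFun h i
      simp only [stepv] at this
      split_ifs at this <;> simp_all
    · rfl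

lemma std_rb (n : ℕ) : rb lab (std n) := by
  constructor
  · intro i
    refine ⟨i.succ, Fin.succ_ne_zero i, ?_⟩
    apply lab_eq
    · intro k hk
      have : k.val < i.val := by simpa using hk
      simp [std, this]
    · intro k hk
      rw [← Fin.castSucc_injective _ hk]
      simp [std]
  · apply lab_eq
    · intro k hk
      simp [std]
    · intro k hk
      exact absurd hk (Fin.castSucc_lt_last k).ne'

lemma unique_rb {n : ℕ} (hn : 1 ≤ n) {f : Pre n} (h : IsFlag f) (hr : rb lab f) :
    f = std n := by
  obtain ⟨hd, h0⟩ := hr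
  have hx0 : ∀ a, 0 ≤ f.1 0 a := lab_last _ h0
  have hle : ∀ i a, f.1 i a ≤ 0 := by
    intro i a
    obtain ⟨j, -, hj⟩ := hd a
    have h1 := lab_neg _ hj
    have h2 := width h i j a
    omega
  have hge : ∀ i a, -1 ≤ f.1 i a := by
    intro i a
    have h1 := hx0 a
    have h2 := width h 0 i a
    omega
  have hpi : f.2 0 = Fin.last n := by
    by_contra hne
    obtain ⟨k, hk⟩ := Fin.exists_castSucc_eq.mpr hne
    have h1 := congrFun (h 0) k
    have h2 := hle (0+1) k
    have h3 := hx0 k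
    simp only [Pi.add_apply, stepv, ← hk, (Fin.castSucc_lt_last k).ne, if_false, if_true] at h1
    omega
  have hmono : ∀ i j : Fin n, i ≤ j → f.1 i.succ ≤ f.1 j.succ := by
    intro i j hij a
    have hl : (rot 1 f).2 (Fin.last n) = Fin.last n := by
      simp [rot, hpi]
    have h1 := normal (h.rot 1) hl i.castSucc a
    have h2 := normal (h.rot 1) hl j.castSucc a
    have e1 : (rot 1 f).1 i.castSucc = f.1 i.succ := by
      simp only [rot]; rw [Fin.coeSucc_eq_succ]
    have e2 : (rot 1 f).1 j.castSucc = f.1 j.succ := by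
      simp only [rot]; rw [Fin.coeSucc_eq_succ]
    rw [e1] at h1
    rw [e2] at h2
    rw [h1, h2]
    by_cases hlt : (rot 1 f).2.symm a.castSucc < i.castSucc
    · have : (rot 1 f).2.symm a.castSucc < j.castSucc := hlt.trans_le (by simpa using hij)
      simp [hlt, this]
    · simp only [hlt, if_false]
      split_ifs <;> omega
  have hinj := door_inj hd
  have hs : ∀ i : Fin n, ∃ k : Fin n, k.castSucc = lab (f.1 i.succ) := fun i =>
    Fin.exists_castSucc_eq.mpr (hinj.1 i.succ (Fin.succ_ne_zero i))
  choose s hs using hs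
  have sinj : Function.Injective s := by
    intro i j hij
    have := hinj.2 i.succ j.succ (Fin.succ_ne_zero i) (Fin.succ_ne_zero j)
      (by rw [← hs, ← hs, hij])
    exact Fin.succ_injective _ this
  have smono : StrictMono s := by
    refine Monotone.strictMono_of_injective ?_ sinj
    intro i j hij
    have := lab_mono (hmono i j hij)
    rw [← hs, ← hs] at this
    simpa using this
  have sid : s = id := by
    refine (StrictMono.range_inj smono strictMono_id).mp ?_
    rw [(Finite.surjective_of_injective sinj).range_eq]
    simp
  have hlab : ∀ i : Fin n, lab (f.1 i.succ) = i.castSucc := by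
    intro i; rw [← hs, sid]; rfl
  have hx : f.1 = (std n).1 := by
    funext j a
    rcases Fin.eq_zero_or_eq_succ j with rfl | ⟨i, rfl⟩
    · have h1 := hx0 a
      have h2 := hle 0 a
      simp [std]; omega
    · by_cases hai : a < i
      · have h1 := lab_nonneg (f.1 i.succ) (k := a) (by rw [hlab]; simpa using hai)
        have h2 := hle i.succ a
        have h3 : a.val < i.val := hai
        simp [std, h3]; omega
      · have h1 : f.1 i.succ a ≤ f.1 a.succ a := hmono i a (not_lt.mp hai) a
        have h2 := lab_neg _ (hlab a)
        have h3 := hge i.succ a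
        have h4 : ¬ a.val < i.val := hai
        simp [std, h4]; omega
  refine Prod.ext hx ?_
  ext j
  congr 1
  apply stepv_inj
  have h1 := h j
  have h2 := std_flag hn j
  rw [hx, h2] at h1
  exact (add_left_cancel h1).symm

theorem exists_rainbow {n : ℕ} (hn : 1 ≤ n) (q : (Fin n → ℤ) → (Fin n → ℤ)) (D M : ℤ)
    (hM : 0 ≤ M) (hout : ∀ v, (∃ a, M < |v a|) → q v = v)
    (hD : ∀ v a, |q v a - v a| ≤ D) :
    ∃ x : Fin (n+1) → Fin n → ℤ, (∀ i j a, |x i a - x j a| ≤ 1) ∧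
      Function.Injective (fun j => q (x j)) ∧ ∀ j a, |x j a| ≤ D + 1 := by
  classical
  let B : Set (Fin n → ℤ) := {v | ∀ a, |v a| ≤ M}
  have hfin : {f : Pre n | IsFlag f ∧ ∃ j, f.1 j ∈ B}.Finite := by
    have : (Set.Icc (fun _ _ => -(M+1)) (fun _ _ => M+1) ×ˢ Set.univ :
        Set (Pre n)).Finite := (Set.finite_Icc _ _).prod Set.finite_univ
    refine this.subset ?_
    rintro f ⟨hf, j, hj⟩
    refine ⟨⟨fun i a => ?_, fun i a => ?_⟩, trivial⟩
    · have h1 := width hf j i a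
      have h2 := abs_le.mp (hj a)
      show -(M+1) ≤ f.1 i a
      omega
    · have h1 := width hf i j a
      have h2 := abs_le.mp (hj a)
      show f.1 i a ≤ M + 1
      omega
  let F : Finset (Pre n) := hfin.toFinset
  have hF : ∀ f, f ∈ F ↔ IsFlag f ∧ ∃ j, f.1 j ∈ B := fun f => hfin.mem_toFinset
  have hFrot : ∀ f ∈ F, ∀ k, rot k f ∈ F := by
    intro f hf k
    rw [hF] at hf ⊢
    obtain ⟨h1, j, hj⟩ := hf
    exact ⟨h1.rot k, j - k, by simpa [rot] using hj⟩
  have h1 := parity_rot (fun v => lab (q v)) F hFrot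
  have h2 := parity_rot lab F hFrot
  have h3 := parity_flip hn (fun v => lab (q v)) lab B (by
    intro v hv
    simp only [B, Set.mem_ofPred_eq, not_forall, not_le] at hv
    simp only [hout v hv]) F hF
  have h4 : F.filter (rb lab) = {std n} := by
    ext f
    simp only [Finset.mem_filter, Finset.mem_singleton, hF]
    constructor
    · rintro ⟨⟨h, -⟩, hr⟩
      exact unique_rb hn h hr
    · rintro rfl
      refine ⟨⟨std_flag hn, 0, ?_⟩, std_rb n⟩
      intro a
      simpa [std] using hM
  have h5 : ((F.filter (rb (fun v => lab (q v)))).card : ZMod 2) = 1 := by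
    rw [← h1, h3, h2, h4]; simp
  have h6 : (F.filter (rb (fun v => lab (q v)))).Nonempty := by
    rw [Finset.nonempty_iff_ne_empty]
    intro h
    rw [h] at h5
    simp at h5
  obtain ⟨f, hf⟩ := h6
  simp only [Finset.mem_filter, hF] at hf
  obtain ⟨⟨hfl, -⟩, hd, h0⟩ := hf
  refine ⟨f.1, fun i j a => ?_, ?_, ?_⟩
  · have h1 := width hfl i j a
    have h2 := width hfl j i a
    rw [abs_le]; omega
  · have hsurj : Function.Surjective (fun j => lab (q (f.1 j))) := by
      intro l
      rcases Fin.eq_castSucc_or_eq_last l with ⟨i, rfl⟩ | rfl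
      · obtain ⟨j, -, hj⟩ := hd i
        exact ⟨j, hj⟩
      · exact ⟨0, h0⟩
    have hinj := Finite.injective_iff_surjective.mpr hsurj
    intro i j hij
    exact hinj (congrArg lab hij)
  · intro i a
    obtain ⟨j, -, hj⟩ := hd a
    have h1 := lab_neg _ hj
    have h2 := lab_last _ h0 a
    have h3 := abs_le.mp (hD (f.1 j) a)
    have h4 := abs_le.mp (hD (f.1 0) a)
    have h5 := width hfl i j a
    have h6 := width hfl 0 i a
    rw [abs_le]; omega

end KuhnSperner

/-! ### Small sets and holes -/

/-- Every point is uniformly close to the centre of an `r`-ball missing `A`. -/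
def Holes {X : Type*} [MetricSpace X] (A : Set X) : Prop :=
  ∀ r > (0 : ℝ), ∃ R > (0 : ℝ), ∀ z : X, ∃ y, dist z y < R ∧ ∀ a ∈ A, r ≤ dist y a

lemma isSmall_iff_holes {X : Type*} [MetricSpace X] (A : Set X) : IsSmall A ↔ Holes A := by
  constructor
  · intro h r hr
    have hL : IsLarge (A ∪ {y | ∀ a ∈ A, r ≤ dist y a}) := by
      refine ⟨r, hr, fun x => ?_⟩
      by_cases hx : ∀ a ∈ A, r ≤ dist x a
      · exact ⟨x, Or.inr hx, by simpa using hr⟩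
      · push Not at hx
        obtain ⟨a, ha, hd⟩ := hx
        exact ⟨a, Or.inl ha, hd⟩
    obtain ⟨R, hR, H⟩ := h _ hL
    refine ⟨R, hR, fun z => ?_⟩
    obtain ⟨y, ⟨hy1, hy2⟩, hd⟩ := H z
    exact ⟨y, hd, hy1.resolve_left hy2⟩
  · rintro h L ⟨r, hr, hL⟩
    obtain ⟨R, hR, H⟩ := h r hr
    refine ⟨R + r, by positivity, fun x => ?_⟩
    obtain ⟨y, hd, hy⟩ := H x
    obtain ⟨l, hl, hd'⟩ := hL y
    refine ⟨l, ⟨hl, fun hA => ?_⟩, ?_⟩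
    · exact absurd hd' (not_lt.mpr (hy l hA))
    · exact (dist_triangle x y l).trans_lt (add_lt_add hd hd')

lemma holes_of_asdim {n : ℕ} (hn : 1 ≤ n) (A : Set (Fin n → ℝ)) (h : AsdimLE ↥A (n - 1)) :
    Holes A := by
  classical
  intro r hr
  obtain ⟨D, hD, U, hU, hdiam, hball⟩ := h (2 * r + 1) (by positivity)
  set D' : ℤ := ⌈r + D⌉ + 1 with hD'
  have hceil : r + D ≤ (⌈r + D⌉ : ℝ) := Int.le_ceil _
  have hD'pos : 0 ≤ D' := by
    have : (0 : ℝ) ≤ (⌈r + D⌉ : ℝ) := by linarith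
    have : (0 : ℤ) ≤ ⌈r + D⌉ := by exact_mod_cast this
    omega
  set M : ℤ := D' + 1 with hM
  have hM0 : 0 ≤ M := by omega
  have hM0' : (0 : ℝ) ≤ M := by exact_mod_cast hM0
  refine ⟨M + 1, by positivity, ?_⟩
  by_contra hcon
  push Not at hcon
  obtain ⟨z, hz⟩ := hcon
  have hex : ∀ v : Fin n → ℤ, (∀ k, |v k| ≤ M) → ∃ a : A, ∃ u : Set A,
      dist (fun k => z k + (v k : ℝ)) (a : Fin n → ℝ) < r ∧ u ∈ U ∧ a ∈ u := by
    intro v hv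
    obtain ⟨a, ha, hd⟩ := hz (fun k => z k + (v k : ℝ)) (by
      refine lt_of_le_of_lt ((dist_pi_le_iff hM0').mpr fun k => ?_) (lt_add_one _)
      rw [Real.dist_eq]
      have : |(v k : ℝ)| ≤ M := by exact_mod_cast hv k
      simpa using this)
    have : (⟨a, ha⟩ : A) ∈ ⋃₀ U := by rw [hU]; trivial
    obtain ⟨u, hu, hau⟩ := this
    exact ⟨⟨a, ha⟩, u, hd, hu, hau⟩
  choose a u hau hu hmem using hex
  let P : Set A → (Fin n → ℝ) := fun s => if h : s.Nonempty then (h.some : Fin n → ℝ) else 0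
  let q : (Fin n → ℤ) → (Fin n → ℤ) := fun v =>
    if h : ∀ k, |v k| ≤ M then fun k => ⌊P (u v h) k - z k⌋ else v
  obtain ⟨x, hx1, hx2, hx3⟩ := KuhnSperner.exists_rainbow hn q D' M hM0 (by
    rintro v ⟨k, hk⟩
    have : ¬ ∀ k, |v k| ≤ M := fun h => absurd (h k) (not_le.mpr hk)
    simp [q, this]) (by
    intro v k
    by_cases hv : ∀ k, |v k| ≤ M
    · simp only [q, hv, implies_true, dif_pos]
      have hne : (u v hv).Nonempty := ⟨_, hmem v hv⟩
      have e1 : P (u v hv) = (hne.some : Fin n → ℝ) := by simp [P, hne]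
      have e2 : dist hne.some (a v hv) ≤ D := by
        have := (EMetric.edist_le_diam_of_mem hne.some_mem (hmem v hv)).trans (hdiam _ (hu v hv))
        rw [edist_dist] at this
        exact (ENNReal.ofReal_le_ofReal_iff hD.le).mp this
      have e3 : |(hne.some : Fin n → ℝ) k - (a v hv : Fin n → ℝ) k| ≤ D := by
        rw [← Real.dist_eq]
        exact (dist_le_pi_dist _ _ k).trans e2
      have e4 : |z k + (v k : ℝ) - (a v hv : Fin n → ℝ) k| < r := by
        have := (dist_le_pi_dist _ _ k).trans_lt (hau v hv)
        rwa [Real.dist_eq] at this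
      rw [e1]
      have e5 := Int.floor_le ((hne.some : Fin n → ℝ) k - z k)
      have e6 := Int.lt_floor_add_one ((hne.some : Fin n → ℝ) k - z k)
      rw [abs_le] at e3
      rw [abs_lt] at e4
      have : |((⌊(hne.some : Fin n → ℝ) k - z k⌋ : ℤ) : ℝ) - (v k : ℝ)| ≤ (D' : ℝ) := by
        rw [abs_le, hD']
        push_cast
        constructor <;> linarith [e3.1, e3.2, e4.1, e4.2]
      exact_mod_cast this
    · simp only [q, hv, dif_neg, not_false_eq_true, sub_self, abs_zero]
      exact hD'pos)
  have hb : ∀ j k, |x j k| ≤ M := fun j k => hx3 j k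
  have hinj : Function.Injective (fun j => u (x j) (hb j)) := by
    intro i j hij
    apply hx2
    simp only at hij
    have e : ∀ j, q (x j) = fun k => ⌊P (u (x j) (hb j)) k - z k⌋ := by
      intro j
      simp only [q, hb j, implies_true, dif_pos]
    simp only [e, hij]
  obtain ⟨hfin, hcard⟩ := hball (a (x 0) (hb 0))
  have hsub : Set.range (fun j => u (x j) (hb j)) ⊆
      {w ∈ U | (w ∩ Metric.ball (a (x 0) (hb 0)) (2 * r + 1)).Nonempty} := by
    rintro _ ⟨j, rfl⟩
    refine ⟨hu _ _, a (x j) (hb j), hmem _ _, ?_⟩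
    rw [Metric.mem_ball, Subtype.dist_eq]
    have h1 := hau (x j) (hb j)
    have h2 := hau (x 0) (hb 0)
    have h3 : dist (fun k => z k + (x j k : ℝ)) (fun k => z k + (x 0 k : ℝ)) ≤ 1 := by
      refine (dist_pi_le_iff zero_le_one).mpr fun k => ?_
      rw [Real.dist_eq]
      have : |(x j k : ℝ) - (x 0 k : ℝ)| ≤ 1 := by exact_mod_cast hx1 j 0 k
      simpa using this
    rw [dist_comm] at h1
    have h4 := dist_triangle4 (a (x j) (hb j) : Fin n → ℝ) (fun k => z k + (x j k : ℝ))
      (fun k => z k + (x 0 k : ℝ)) (a (x 0) (hb 0) : Fin n → ℝ)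
    linarith
  have h1 := Set.ncard_le_ncard hsub hfin
  have h2 : (Set.range (fun j => u (x j) (hb j))).ncard = n + 1 := by
    rw [← Set.image_univ, Set.ncard_image_of_injective _ hinj, Set.ncard_univ]
    simp
  omega

/-! ### Colouring the complement of a lattice of holes -/

section Colour

/-- distance to the lattice `s ℤ` -/
noncomputable def latDist (s t : ℝ) : ℝ := |t - s * round (t / s)|

lemma latDist_le {s : ℝ} (hs : 0 < s) (t : ℝ) (m : ℤ) : latDist s t ≤ |t - s * m| := by
  have h := round_le (t / s) m
  have e : ∀ k : ℤ, |t - s * k| = s * |t / s - k| := by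
    intro k
    rw [← abs_of_pos hs, ← abs_mul, abs_of_pos hs, mul_sub, mul_div_cancel₀ _ hs.ne']
  rw [latDist, e, e]
  exact mul_le_mul_of_nonneg_left h hs.le

lemma latDist_le_half {s : ℝ} (hs : 0 < s) (t : ℝ) : latDist s t ≤ s / 2 := by
  have h := abs_sub_round (t / s)
  have e : latDist s t = s * |t / s - round (t / s)| := by
    rw [latDist, ← abs_of_pos hs, ← abs_mul, abs_of_pos hs, mul_sub, mul_div_cancel₀ _ hs.ne']
  rw [e]
  nlinarith

lemma latDist_lip {s : ℝ} (hs : 0 < s) (t t' : ℝ) : latDist s t ≤ latDist s t' + |t - t'| := by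
  refine (latDist_le hs t (round (t' / s))).trans ?_
  rw [latDist, add_comm]
  exact abs_sub_le t t' _

noncomputable def lset {n : ℕ} (s c : ℝ) (y : Fin n → ℝ) : Finset (Fin n) :=
  Finset.univ.filter (fun i => c < latDist s (y i))

lemma mem_lset {n : ℕ} {s c : ℝ} {y : Fin n → ℝ} {i : Fin n} :
    i ∈ lset s c y ↔ c < latDist s (y i) := by simp [lset]

lemma exists_colour {n : ℕ} (hn : 1 ≤ n) (δ s : ℝ) (y : Fin n → ℝ) : ∃ k : ℕ,
    (lset s (k * δ) y).card + k ≤ n ∧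
    ((∃ i, n * δ < latDist s (y i)) → k < n ∧ n ≤ (lset s ((k + 1 : ℕ) * δ) y).card + k) := by
  classical
  by_cases h : ∃ i, n * δ < latDist s (y i)
  · have hex : ∃ k, n ≤ (lset s ((k + 1 : ℕ) * δ) y).card + k := by
      exact ⟨n, by omega⟩
    have hk := Nat.find_spec hex
    have hle : Nat.find hex ≤ n - 1 := by
      apply Nat.find_min'
      have : n - 1 + 1 = n := by omega
      rw [this]
      obtain ⟨i, hi⟩ := h
      have : 0 < (lset s (n * δ) y).card := Finset.card_pos.mpr ⟨i, mem_lset.mpr hi⟩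
      omega
    refine ⟨Nat.find hex, ?_, fun _ => ⟨by omega, hk⟩⟩
    rcases Nat.eq_zero_or_pos (Nat.find hex) with h0 | h0
    · have := Finset.card_le_univ (lset s ((Nat.find hex : ℕ) * δ) y)
      simp only [Fintype.card_fin] at this
      omega
    · have := Nat.find_min hex (m := Nat.find hex - 1) (by omega)
      have e : Nat.find hex - 1 + 1 = Nat.find hex := by omega
      rw [e] at this
      omega
  · refine ⟨0, ?_, fun h' => absurd h' h⟩
    have := Finset.card_le_univ (lset s ((0 : ℕ) * δ) y)
    simp only [Fintype.card_fin] at this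
    omega

lemma colouring {n : ℕ} (hn : 1 ≤ n) (δ s : ℝ) (hδ : 0 < δ) (hs : (2 * n + 1) * δ < s) :
    ∃ (col : (Fin n → ℝ) → ℕ) (code : (Fin n → ℝ) → Finset (Fin n) × (Fin n → ℤ)),
      (∀ y, (∃ i, n * δ < latDist s (y i)) → col y < n) ∧
      (∀ y y', (∃ i, n * δ < latDist s (y i)) → (∃ i, n * δ < latDist s (y' i)) →
        col y = col y' → dist y y' < δ → code y = code y') ∧
      (∀ y y', code y = code y' → dist y y' ≤ s) := by
  classical
  have hs0 : 0 < s := lt_trans (by positivity) hs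
  choose col hc1 hc2 using fun y => exists_colour hn δ s y
  let S : (Fin n → ℝ) → Finset (Fin n) := fun y => lset s ((col y + 1 : ℕ) * δ) y
  refine ⟨col, fun y => (S y, fun i => if i ∈ S y then ⌊y i / s⌋ else round (y i / s)),
    fun y hy => (hc2 y hy).1, ?_, ?_⟩
  · have hsub : ∀ y y', (∃ i, n * δ < latDist s (y i)) → (∃ i, n * δ < latDist s (y' i)) →
        col y = col y' → dist y y' < δ → S y ⊆ S y' := by
      intro y y' hy hy' hcol hd i hi
      have h1 : S y' ⊆ lset s (col y' * δ) y' := by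
        intro k hk
        rw [mem_lset] at hk ⊢
        refine lt_of_le_of_lt ?_ hk
        push_cast
        nlinarith
      have h2 : S y' = lset s (col y' * δ) y' := by
        apply Finset.eq_of_subset_of_card_le h1
        have := hc1 y'
        have := (hc2 y' hy').2
        simp only [S]
        omega
      rw [h2, mem_lset]
      have h3 := mem_lset.mp hi
      have h4 := latDist_lip hs0 (y i) (y' i)
      have h5 : |y i - y' i| < δ := by
        rw [← Real.dist_eq]; exact (dist_le_pi_dist y y' i).trans_lt hd
      rw [hcol] at h3
      push_cast at h3
      nlinarith
    intro y y' hy hy' hcol hd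
    have hS : S y = S y' := Finset.Subset.antisymm (hsub y y' hy hy' hcol hd)
      (hsub y' y hy' hy hcol.symm (by rwa [dist_comm]))
    refine Prod.ext hS ?_
    funext i
    have hdi : |y i - y' i| < δ := by
      rw [← Real.dist_eq]; exact (dist_le_pi_dist y y' i).trans_lt hd
    simp only [← hS]
    by_cases hi : i ∈ S y
    · simp only [hi, if_true]
      have hi' := hi
      rw [hS] at hi'
      have b : ∀ y, i ∈ S y → δ < latDist s (y i) := by
        intro y hy
        have := mem_lset.mp hy
        push_cast at this
        have h0 : (0 : ℝ) ≤ col y * δ := by positivity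
        linarith
      have key : ∀ y y' : Fin n → ℝ, |y i - y' i| < δ → δ < latDist s (y' i) →
          ⌊y' i / s⌋ ≤ ⌊y i / s⌋ := by
        intro y y' h1 h2
        by_contra hlt
        push Not at hlt
        have h3 : y i / s < (⌊y' i / s⌋ : ℝ) := Int.floor_lt.mp hlt
        have h4 := Int.floor_le (y' i / s)
        rw [div_lt_iff₀ hs0] at h3
        rw [le_div_iff₀ hs0] at h4
        have h5 := latDist_le hs0 (y' i) ⌊y' i / s⌋
        rw [abs_of_nonneg (by linarith)] at h5
        have := (abs_lt.mp h1).1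
        linarith
      exact le_antisymm (key y' y (by rwa [abs_sub_comm]) (b y hi)) (key y y' hdi (b y' hi'))
    · simp only [hi, if_false]
      have hi' := hi
      rw [hS] at hi'
      have b : ∀ y, (∃ i, n * δ < latDist s (y i)) → i ∉ S y →
          |y i - s * round (y i / s)| ≤ n * δ := by
        intro y hy hiy
        have h1 := (hc2 y hy).1
        have h2 : latDist s (y i) ≤ (col y + 1 : ℕ) * δ := not_lt.mp fun h => hiy (mem_lset.mpr h)
        refine h2.trans ?_
        have : ((col y + 1 : ℕ) : ℝ) ≤ n := by exact_mod_cast h1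
        exact mul_le_mul_of_nonneg_right this hδ.le
      have b1 := abs_le.mp (b y hy hi)
      have b2 := abs_le.mp (b y' hy' hi')
      have b3 := abs_lt.mp hdi
      have key : ∀ m m' : ℤ, s * (m : ℝ) - s * m' < s → m ≤ m' := by
        intro m m' h
        have h1 : (m : ℝ) - m' < 1 := by
          by_contra hc
          push Not at hc
          nlinarith
        have : (m : ℝ) < m' + 1 := by linarith
        have : m < m' + 1 := by exact_mod_cast this
        omega
      apply le_antisymm
      · apply key; linarith
      · apply key; linarith
  · intro y y' h
    rw [Prod.ext_iff] at h
    obtain ⟨h1, h2⟩ := h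
    simp only at h1 h2
    refine (dist_pi_le_iff hs0.le).mpr fun i => ?_
    have h3 := congrFun h2 i
    simp only [← h1] at h3
    rw [Real.dist_eq]
    by_cases hi : i ∈ S y
    · simp only [hi, if_true] at h3
      have a1 := Int.floor_le (y i / s)
      have a2 := Int.lt_floor_add_one (y i / s)
      have a3 := Int.floor_le (y' i / s)
      have a4 := Int.lt_floor_add_one (y' i / s)
      rw [le_div_iff₀ hs0] at a1 a3
      rw [div_lt_iff₀ hs0] at a2 a4
      rw [h3] at a1 a2
      rw [abs_le]
      constructor <;> linarith
    · simp only [hi, if_false] at h3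
      have a1 := latDist_le_half hs0 (y i)
      have a2 := latDist_le_half hs0 (y' i)
      rw [latDist, abs_le] at a1 a2
      rw [h3] at a1
      rw [abs_le]
      constructor <;> linarith [a1.1, a1.2, a2.1, a2.2]

end Colour

/-- Move the holes to lattice position. -/
lemma straighten {n : ℕ} (A : Set (Fin n → ℝ)) (R r' : ℝ) (hr' : 0 < r') (hR : 2 * r' ≤ R)
    (H : ∀ z, ∃ y, dist z y < R ∧ ∀ a ∈ A, r' ≤ dist y a) :
    ∃ Y : (Fin n → ℝ) → (Fin n → ℝ), (∀ x, dist x (Y x) ≤ R) ∧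
      (∀ x x', dist (Y x) (Y x') ≤ 5 * dist x x') ∧
      ∀ a ∈ A, ∃ i, r' ≤ latDist (4 * R) (Y a i) := by
  have hR0 : 0 < R := by linarith
  choose c hc1 hc2 using H
  let m : (Fin n → ℝ) → (Fin n → ℤ) := fun x i => round (x i / (4 * R))
  let p : (Fin n → ℤ) → (Fin n → ℝ) := fun v i => 4 * R * (v i : ℝ)
  let t : (Fin n → ℝ) → ℝ := fun x => dist x (p (m x))
  let w : (Fin n → ℝ) → ℝ := fun x => min 1 ((2 * R - t x) * (2 / R))
  have hmi : ∀ x i, |x i - p (m x) i| ≤ 2 * R := by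
    intro x i
    have := latDist_le_half (s := 4 * R) (by positivity) (x i)
    have e : latDist (4 * R) (x i) = |x i - p (m x) i| := rfl
    rw [← e]; linarith
  have ht : ∀ x, t x ≤ 2 * R := fun x =>
    (dist_pi_le_iff (by positivity)).mpr fun i => by rw [Real.dist_eq]; exact hmi x i
  have hw0 : ∀ x, 0 ≤ w x := fun x =>
    le_min zero_le_one (mul_nonneg (by linarith [ht x]) (by positivity))
  have hw1 : ∀ x, w x ≤ 1 := fun x => min_le_left _ _
  have hcR : ∀ v i, |c (p v) i - p v i| ≤ R := by
    intro v i
    rw [← Real.dist_eq, dist_comm]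
    exact (dist_le_pi_dist _ _ i).trans (hc1 _).le
  let o : (Fin n → ℝ) → (Fin n → ℝ) := fun x i => w x * (c (p (m x)) i - p (m x) i)
  have ho : ∀ x i, |o x i| ≤ w x * R := by
    intro x i
    simp only [o, abs_mul, abs_of_nonneg (hw0 x)]
    exact mul_le_mul_of_nonneg_left (hcR _ _) (hw0 x)
  have ho' : ∀ x i, |o x i| ≤ R := fun x i =>
    (ho x i).trans (by nlinarith [hw1 x])
  have hfar : ∀ x x', m x ≠ m x' → w x * R ≤ 2 * dist x x' := by
    intro x x' hne
    obtain ⟨i, hi⟩ := Function.ne_iff.mp hne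
    have h1 : 2 * R ≤ dist x' (p (m x)) := by
      refine le_trans ?_ (dist_le_pi_dist _ _ i)
      rw [Real.dist_eq]
      have h2 := hmi x' i
      have h3 : 4 * R ≤ |p (m x') i - p (m x) i| := by
        have : (1 : ℝ) ≤ |(m x' i : ℝ) - (m x i : ℝ)| := by
          have : (1 : ℤ) ≤ |m x' i - m x i| := Int.one_le_abs (sub_ne_zero.mpr (Ne.symm hi))
          exact_mod_cast this
        simp only [p]
        rw [← mul_sub, abs_mul, abs_of_pos (by positivity : 0 < 4 * R)]
        nlinarith
      have h4 := abs_sub_le (p (m x') i) (x' i) (p (m x) i)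
      rw [abs_sub_comm (p (m x') i) (x' i)] at h4
      linarith
    have h2 : dist x' (p (m x)) ≤ dist x x' + t x := by
      rw [dist_comm x x']; exact dist_triangle _ _ _
    have h3 : w x ≤ (2 * R - t x) * (2 / R) := min_le_right _ _
    have h4 : w x * R ≤ (2 * R - t x) * 2 := by
      calc w x * R ≤ (2 * R - t x) * (2 / R) * R := mul_le_mul_of_nonneg_right h3 hR0.le
        _ = _ := by field_simp
    linarith
  have hlip : ∀ x x' i, |o x i - o x' i| ≤ 4 * dist x x' := by
    intro x x' i
    by_cases hm : m x = m x'
    · have h1 : |t x - t x'| ≤ dist x x' := by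
        simp only [t, hm]
        exact abs_dist_sub_le _ _ _
      have h2 : |w x - w x'| ≤ dist x x' * (2 / R) := by
        have := abs_min_sub_min_le_max 1 ((2 * R - t x) * (2 / R)) 1 ((2 * R - t x') * (2 / R))
        refine this.trans ?_
        rw [sub_self, abs_zero, max_eq_right (abs_nonneg _), ← sub_mul, abs_mul,
          abs_of_pos (by positivity : 0 < 2 / R)]
        refine mul_le_mul_of_nonneg_right ?_ (by positivity)
        have e : 2 * R - t x - (2 * R - t x') = t x' - t x := by ring
        rw [e, abs_sub_comm]
        exact h1
      have e : o x i - o x' i = (w x - w x') * (c (p (m x)) i - p (m x) i) := by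
        simp only [o, hm]; ring
      rw [e, abs_mul]
      calc _ ≤ dist x x' * (2 / R) * R :=
            mul_le_mul h2 (hcR _ _) (abs_nonneg _) (by positivity)
        _ = 2 * dist x x' := by field_simp
        _ ≤ _ := by linarith [dist_nonneg (x := x) (y := x')]
    · have h1 := hfar x x' hm
      have h2 := hfar x' x (Ne.symm hm)
      rw [dist_comm x' x] at h2
      have h3 := ho x i
      have h4 := ho x' i
      have h5 := abs_sub (o x i) (o x' i)
      linarith
  refine ⟨fun x i => x i - o x i, ?_, ?_, ?_⟩
  · intro x
    refine (dist_pi_le_iff hR0.le).mpr fun i => ?_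
    rw [Real.dist_eq]
    simpa using ho' x i
  · intro x x'
    refine (dist_pi_le_iff (by positivity)).mpr fun i => ?_
    rw [Real.dist_eq]
    have h1 := hlip x x' i
    have h2 := dist_le_pi_dist x x' i
    rw [Real.dist_eq] at h2
    have h3 := abs_sub (x i - x' i) (o x i - o x' i)
    have e : x i - o x i - (x' i - o x' i) = x i - x' i - (o x i - o x' i) := by ring
    rw [e]; linarith
  · intro a ha
    have key : ∃ i, r' ≤ |a i - o a i - p (m a) i| ∧ |a i - o a i - p (m a) i| ≤ 3 * R := by
      by_cases hta : t a ≤ 3 / 2 * R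
      · have hw : w a = 1 := by
          apply min_eq_left
          calc (1 : ℝ) = (R / 2) * (2 / R) := by field_simp
            _ ≤ _ := mul_le_mul_of_nonneg_right (by linarith) (by positivity)
        have h1 : ∃ i, r' ≤ |c (p (m a)) i - a i| := by
          by_contra hcon
          push Not at hcon
          have := (dist_pi_lt_iff hr').mpr (fun i => by rw [Real.dist_eq]; exact hcon i)
          exact absurd this (not_lt.mpr (hc2 (p (m a)) a ha))
        obtain ⟨i, hi⟩ := h1
        have e : a i - o a i - p (m a) i = a i - c (p (m a)) i := by
          simp only [o, hw]; ring
        refine ⟨i, ?_, ?_⟩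
        · rw [e, abs_sub_comm]; exact hi
        · rw [e]
          have h2 := hcR (m a) i
          have h3 := (dist_le_pi_dist a (p (m a)) i).trans hta
          rw [Real.dist_eq] at h3
          have h4 := abs_sub_le (a i) (p (m a) i) (c (p (m a)) i)
          rw [abs_sub_comm (p (m a) i)] at h4
          linarith
      · have h1 : ∃ i, 3 / 2 * R < |a i - p (m a) i| := by
          by_contra hcon
          push Not at hcon
          exact hta ((dist_pi_le_iff (by positivity)).mpr
            (fun i => by rw [Real.dist_eq]; exact hcon i))
        obtain ⟨i, hi⟩ := h1
        have h2 := hmi a i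
        have h3 := ho' a i
        have e : a i - o a i - p (m a) i = a i - p (m a) i - o a i := by ring
        have h4 := abs_sub (a i - p (m a) i) (o a i)
        have h5 := abs_sub_abs_le_abs_sub (a i - p (m a) i) (o a i)
        refine ⟨i, ?_, ?_⟩
        · rw [e]; linarith
        · rw [e]; linarith
    obtain ⟨i, h1, h2⟩ := key
    refine ⟨i, ?_⟩
    rw [latDist]
    set k := round ((a i - o a i) / (4 * R))
    by_cases hk : k = m a i
    · rw [hk]; exact h1
    · have h3 : 4 * R ≤ |p (m a) i - 4 * R * (k : ℝ)| := by
        have : (1 : ℝ) ≤ |(m a i : ℝ) - (k : ℝ)| := by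
          have : (1 : ℤ) ≤ |m a i - k| := Int.one_le_abs (sub_ne_zero.mpr (Ne.symm hk))
          exact_mod_cast this
        simp only [p]
        rw [← mul_sub, abs_mul, abs_of_pos (by positivity : 0 < 4 * R)]
        nlinarith
      have h4 := abs_sub_le (p (m a) i) (a i - o a i) (4 * R * (k : ℝ))
      rw [abs_sub_comm (p (m a) i) (a i - o a i)] at h4
      linarith

lemma asdim_of_holes {n : ℕ} (hn : 1 ≤ n) (A : Set (Fin n → ℝ)) (h : Holes A) :
    AsdimLE ↥A (n - 1) := by
  classical
  intro r hr
  set δ : ℝ := 10 * r with hδ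
  have hδ0 : 0 < δ := by positivity
  set r' : ℝ := (n + 1) * δ with hr'
  have hr'0 : 0 < r' := by positivity
  obtain ⟨R0, hR0, H⟩ := h r' hr'0
  set R : ℝ := R0 + 2 * r' with hR
  have hRpos : 0 < R := by positivity
  obtain ⟨Y, hY1, hY2, hY3⟩ := straighten A R r' hr'0 (by linarith) (by
    intro z
    obtain ⟨y, h1, h2⟩ := H z
    exact ⟨y, by linarith, h2⟩)
  have hYA : ∀ a : A, ∃ i, n * δ < latDist (4 * R) (Y a i) := by
    intro a
    obtain ⟨i, hi⟩ := hY3 a a.2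
    exact ⟨i, by linarith⟩
  obtain ⟨col, code, hc1, hc2, hc3⟩ := colouring hn δ (4 * R) hδ0 (by
    have : (0 : ℝ) ≤ n * δ := by positivity
    linarith)
  let fib : A → Set A := fun a => {b | col (Y b) = col (Y a) ∧ code (Y b) = code (Y a)}
  refine ⟨6 * R, by positivity, Set.range fib, ?_, ?_, ?_⟩
  · refine Set.eq_univ_of_forall fun a => ?_
    exact ⟨fib a, ⟨a, rfl⟩, rfl, rfl⟩
  · rintro _ ⟨a, rfl⟩
    refine EMetric.diam_le fun b hb b' hb' => ?_
    rw [edist_dist]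
    apply ENNReal.ofReal_le_ofReal
    rw [Subtype.dist_eq]
    have h1 := hc3 (Y b) (Y b') (hb.2.trans hb'.2.symm)
    have h2 := hY1 b
    have h3 := hY1 b'
    rw [dist_comm] at h3
    have h4 := dist_triangle4 (b : Fin n → ℝ) (Y b) (Y b') b'
    linarith
  · intro x
    let Φ : ℕ → Set A := fun k => {b | col (Y b) = k ∧
      ∃ a ∈ Metric.ball x r, col (Y (a : A)) = k ∧ code (Y b) = code (Y a)}
    have hsub : {u ∈ Set.range fib | (u ∩ Metric.ball x r).Nonempty} ⊆
        Set.image Φ (Finset.range n : Set ℕ) := by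
      rintro _ ⟨⟨b, rfl⟩, a, ⟨ha1, ha2⟩, hax⟩
      refine ⟨col (Y a), by simpa using hc1 _ (hYA a), ?_⟩
      ext b'
      constructor
      · rintro ⟨h1, a', ha', h2, h3⟩
        refine ⟨h1.trans ha1, h3.trans ?_⟩
        rw [← ha2]
        apply hc2 _ _ (hYA a') (hYA a) h2
        have h4 := hY2 a' a
        have h5 : dist (a' : Fin n → ℝ) a < 2 * r := by
          rw [← Subtype.dist_eq]
          have := dist_triangle_right a' a x
          rw [Metric.mem_ball] at ha' hax
          linarith
        linarith
      · rintro ⟨h1, h2⟩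
        exact ⟨h1.trans ha1.symm, a, hax, rfl, h2.trans ha2.symm⟩
    have hfin : (Set.image Φ (Finset.range n : Set ℕ)).Finite := (Finset.finite_toSet _).image _
    refine ⟨hfin.subset hsub, ?_⟩
    have h1 := Set.ncard_le_ncard hsub hfin
    have h2 := Set.ncard_image_le (f := Φ) (Finset.finite_toSet (Finset.range n))
    rw [Set.ncard_coe_finset, Finset.card_range] at h2
    omega

theorem small_iff_asdim_lt_euclidean (n : ℕ) (hn : 1 ≤ n) (A : Set (Fin n → ℝ)) :
    IsSmall A ↔ AsdimLE ↥A (n - 1) := by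
  rw [isSmall_iff_holes]
  exact ⟨asdim_of_holes hn A, holes_of_asdim hn A⟩
end

section
/- Let n ≥ 1 and let X be a metric space that is coarsely equivalent to ℝ^n (Fin n → ℝ with the sup-metric). Then a subset A ⊆ X is small if and only if A has asymptotic dimension at most n − 1. -/
open Metric Set

/-- unit step -/
def stp {n : ℕ} (a : Fin n) (x : Fin n → ℕ) : Fin n → ℕ := x + Pi.single a 1

/-- signed sum over lattice paths -/
noncomputable def gen {n : ℕ} (F : (Fin n → ℕ) → (Fin n → ℝ)) : (k : ℕ) → (Fin k → Fin n) →
    ((Fin k → Fin n → ℝ) → ℝ) → (Fin n → ℕ) → ℝ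
  | 0, _, M, _ => M Fin.elim0
  | k + 1, d, M, x => ∑ i : Fin (k + 1), (-1 : ℝ) ^ (i : ℕ) *
      gen F k (d ∘ i.succAbove) (fun w => M (Fin.cons (F (stp (d i) x) - F x) w)) (stp (d i) x)

lemma gen_sum {n : ℕ} (F : (Fin n → ℕ) → (Fin n → ℝ)) (k : ℕ) : ∀ (d : Fin k → Fin n)
    {J : Type} [Fintype J] (c : J → ℝ) (M : J → (Fin k → Fin n → ℝ) → ℝ) (x : Fin n → ℕ),
    gen F k d (fun w => ∑ j, c j * M j w) x = ∑ j, c j * gen F k d (M j) x := by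
  induction k with
  | zero => intros; simp [gen]
  | succ k ih =>
    intro d J _ c M x
    simp only [gen]
    simp_rw [ih, Finset.mul_sum]
    rw [Finset.sum_comm]
    refine Finset.sum_congr rfl fun j _ => Finset.sum_congr rfl fun i _ => by ring

lemma gen_path {n : ℕ} (F : (Fin n → ℕ) → (Fin n → ℝ)) (k : ℕ) : ∀ (d : Fin k → Fin n)
    (M : (Fin k → Fin n → ℝ) → ℝ) (x : Fin n → ℕ), gen F k d M x ≠ 0 →
    ∃ v : Fin (k + 1) → (Fin n → ℕ), v 0 = x ∧
      (∀ j a, x a ≤ v j a ∧ v j a ≤ x a + k) ∧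
      M (fun j => F (v j.succ) - F (v j.castSucc)) ≠ 0 := by
  induction k with
  | zero =>
    intro d M x h
    refine ⟨fun _ => x, rfl, by simp, ?_⟩
    convert h
    simp only [gen]
    congr 1
    funext j; exact j.elim0
  | succ k ih =>
    intro d M x h
    simp only [gen] at h
    obtain ⟨i, -, hi⟩ := Finset.exists_ne_zero_of_sum_ne_zero h
    obtain ⟨v, hv0, hv, hM⟩ := ih _ _ _ (right_ne_zero_of_mul hi)
    refine ⟨Fin.cons x v, rfl, ?_, ?_⟩
    · intro j a
      refine Fin.cases ?_ (fun j => ?_) j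
      · simp
      · have h1 : x a ≤ stp (d i) x a := by simp [stp]
        have h2 : stp (d i) x a ≤ x a + 1 := by
          simp only [stp, Pi.add_apply, Pi.single_apply]; split_ifs <;> simp
        have := hv j a
        simp only [Fin.cons_succ]
        omega
    · convert hM using 2
      funext j
      refine Fin.cases ?_ (fun j => ?_) j
      · simp [hv0]
      · simp

/-- minor of a tuple of vectors -/
noncomputable def minor {n k : ℕ} (q : Fin k → Fin n) (w : Fin k → Fin n → ℝ) : ℝ :=
  Matrix.det (Matrix.of fun j i => w j (q i))

lemma minor_cons {n k : ℕ} (q : Fin (k + 1) → Fin n) (v : Fin n → ℝ) (w : Fin k → Fin n → ℝ) :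
    minor q (Fin.cons v w : Fin (k + 1) → Fin n → ℝ) =
      ∑ i : Fin (k + 1), ((-1 : ℝ) ^ (i : ℕ) * v (q i)) * minor (q ∘ i.succAbove) w := by
  unfold minor
  rw [Matrix.det_succ_row_zero]
  rfl

/-- the cochain attached to minors -/
noncomputable def Om {n : ℕ} (F : (Fin n → ℕ) → (Fin n → ℝ)) (k : ℕ) (d q : Fin k → Fin n)
    (x : Fin n → ℕ) : ℝ := gen F k d (minor q) x

lemma Om_zero {n : ℕ} (F : (Fin n → ℕ) → (Fin n → ℝ)) (d q : Fin 0 → Fin n)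
    (x : Fin n → ℕ) : Om F 0 d q x = 1 := by
  simp [Om, gen, minor]

lemma Om_succ {n : ℕ} (F : (Fin n → ℕ) → (Fin n → ℝ)) (k : ℕ) (d q : Fin (k + 1) → Fin n)
    (x : Fin n → ℕ) : Om F (k + 1) d q x = ∑ i' : Fin (k + 1), (-1 : ℝ) ^ (i' : ℕ) *
      ∑ i : Fin (k + 1), (-1 : ℝ) ^ (i : ℕ) * ((F (stp (d i) x) (q i') - F x (q i')) *
        Om F k (d ∘ i.succAbove) (q ∘ i'.succAbove) (stp (d i) x)) := by
  simp only [Om, gen]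
  simp_rw [minor_cons, gen_sum, Finset.mul_sum]
  rw [Finset.sum_comm]
  refine Finset.sum_congr rfl fun j _ => Finset.sum_congr rfl fun i _ => ?_
  simp only [Pi.sub_apply]
  ring

lemma stp_comm {n : ℕ} (a b : Fin n) (x : Fin n → ℕ) : stp a (stp b x) = stp b (stp a x) := by
  simp only [stp]; abel

lemma d_squared {k : ℕ} (H : Fin (k + 2) → Fin (k + 1) → ℝ)
    (hH : ∀ i j, H (i.succAbove j) (j.predAbove i) = H i j) :
    ∑ i : Fin (k + 2), (-1 : ℝ) ^ (i : ℕ) *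
      ∑ j : Fin (k + 1), (-1 : ℝ) ^ (j : ℕ) * H i j = 0 := by
  simp_rw [Finset.mul_sum]
  rw [← Finset.sum_product']
  refine Finset.sum_involution (fun p _ => (p.1.succAbove p.2, p.2.predAbove p.1)) ?_ ?_ ?_ ?_
  · rintro ⟨i, j⟩ _
    have := Fin.neg_one_pow_succAbove_add_predAbove (R := ℝ) i j
    rw [pow_add, pow_add] at this
    simp only [hH, ← mul_assoc, this]
    ring
  · rintro ⟨i, j⟩ _ _ h
    exact Fin.succAbove_ne i j (congrArg Prod.fst h)
  · simp
  · rintro ⟨i, j⟩ _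
    simp only [Fin.succAbove_succAbove_predAbove, Fin.predAbove_predAbove_succAbove]

lemma Om_exact_of_closed {n : ℕ} (F : (Fin n → ℕ) → (Fin n → ℝ)) (k : ℕ)
    (hc : ∀ (d : Fin (k + 1) → Fin n) (q : Fin k → Fin n) (x : Fin n → ℕ),
      ∑ i : Fin (k + 1), (-1 : ℝ) ^ (i : ℕ) *
        (Om F k (d ∘ i.succAbove) q (stp (d i) x) - Om F k (d ∘ i.succAbove) q x) = 0)
    (d q : Fin (k + 1) → Fin n) (x : Fin n → ℕ) :
    Om F (k + 1) d q x = ∑ i' : Fin (k + 1), (-1 : ℝ) ^ (i' : ℕ) *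
      ∑ i : Fin (k + 1), (-1 : ℝ) ^ (i : ℕ) *
        (F (stp (d i) x) (q i') * Om F k (d ∘ i.succAbove) (q ∘ i'.succAbove) (stp (d i) x) -
          F x (q i') * Om F k (d ∘ i.succAbove) (q ∘ i'.succAbove) x) := by
  rw [Om_succ]
  refine Finset.sum_congr rfl fun i' _ => ?_
  congr 1
  have := hc d (q ∘ i'.succAbove) x
  rw [← sub_eq_zero, ← Finset.sum_sub_distrib]
  rw [← mul_zero (-F x (q i')), ← this, Finset.mul_sum]
  refine Finset.sum_congr rfl fun i _ => ?_
  ring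

lemma Om_closed {n : ℕ} (F : (Fin n → ℕ) → (Fin n → ℝ)) (k : ℕ) :
    ∀ (d : Fin (k + 1) → Fin n) (q : Fin k → Fin n) (x : Fin n → ℕ),
      ∑ i : Fin (k + 1), (-1 : ℝ) ^ (i : ℕ) *
        (Om F k (d ∘ i.succAbove) q (stp (d i) x) - Om F k (d ∘ i.succAbove) q x) = 0 := by
  induction k with
  | zero => intro d q x; simp [Om_zero]
  | succ k ih =>
    intro d q x
    simp_rw [Om_exact_of_closed F k ih, ← Finset.sum_sub_distrib, ← mul_sub,
      ← Finset.sum_sub_distrib, ← mul_sub]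
    simp_rw [Finset.mul_sum]
    rw [Finset.sum_comm]
    refine Finset.sum_eq_zero fun i' _ => ?_
    set h : (Fin k → Fin n) → (Fin n → ℕ) → ℝ := fun e y =>
      F y (q i') * Om F k e (q ∘ i'.succAbove) y with hh
    have key := d_squared (k := k) (fun i j =>
      h ((d ∘ i.succAbove) ∘ j.succAbove) (stp ((d ∘ i.succAbove) j) (stp (d i) x)) -
      h ((d ∘ i.succAbove) ∘ j.succAbove) (stp (d i) x) -
      (h ((d ∘ i.succAbove) ∘ j.succAbove) (stp ((d ∘ i.succAbove) j) x) -
      h ((d ∘ i.succAbove) ∘ j.succAbove) x)) ?_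
    · rw [← mul_zero ((-1 : ℝ) ^ (i' : ℕ)), ← key, Finset.mul_sum]
      refine Finset.sum_congr rfl fun i _ => ?_
      rw [Finset.mul_sum, Finset.mul_sum]
      refine Finset.sum_congr rfl fun j _ => ?_
      simp only [hh]
      ring
    · intro i j
      have e1 : (d ∘ (i.succAbove j).succAbove) ∘ (j.predAbove i).succAbove =
          (d ∘ i.succAbove) ∘ j.succAbove := by
        funext l
        simp only [Function.comp]
        rw [Fin.succAbove_succAbove_succAbove_predAbove]
      simp only [e1]
      simp only [Function.comp, Fin.succAbove_succAbove_predAbove]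
      rw [stp_comm]
      ring

lemma Om_vanish {n : ℕ} (F : (Fin n → ℕ) → (Fin n → ℝ)) (b : Fin n) (k : ℕ) :
    ∀ (d q : Fin k → Fin n) (x : Fin n → ℕ) (i0 : Fin k), q i0 = b → (∀ i, d i ≠ b) →
      (∀ y z : Fin n → ℕ, y b = x b → z b = x b → F y b = F z b) → Om F k d q x = 0 := by
  induction k with
  | zero => intro d q x i0; exact i0.elim0
  | succ k ih =>
    intro d q x i0 hq hd hF
    have hs : ∀ i, stp (d i) x b = x b := by
      intro i; simp [stp, (hd i).symm]
    rw [Om_succ]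
    refine Finset.sum_eq_zero fun i' _ => ?_
    rw [Finset.sum_eq_zero, mul_zero]
    intro i _
    by_cases h : i' = i0
    · subst h
      rw [hq, hF _ x (hs i) rfl]; simp
    · obtain ⟨j, hj⟩ := Fin.exists_succAbove_eq (Ne.symm h)
      rw [ih _ _ _ j]
      · simp
      · simp [hj, hq]
      · intro i; exact hd _
      · rw [hs]; exact hF

/-- a box in the lattice -/
def lbox {n : ℕ} (N : ℕ) (S : Finset (Fin n)) : Finset (Fin n → ℕ) :=
  Fintype.piFinset (fun a => if a ∈ S then Finset.range N else {N})

lemma lbox_sum {n : ℕ} (N : ℕ) (S : Finset (Fin n)) (a : Fin n) (ha : a ∈ S)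
    (g : (Fin n → ℕ) → ℝ) :
    ∑ x ∈ lbox N S, g x =
      ∑ y ∈ lbox N (S.erase a), ∑ t ∈ Finset.range N, g (Function.update y a t) := by
  rw [← Finset.sum_product']
  refine Finset.sum_bij' (fun x _ => (Function.update x a N, x a))
    (fun p _ => Function.update p.1 a p.2) ?_ ?_ ?_ ?_ ?_
  · intro x hx
    simp only [lbox, Fintype.mem_piFinset, Finset.mem_product] at hx ⊢
    constructor
    · intro b
      have := hx b
      by_cases hb : b = a
      · subst hb; simp
      · simpa [hb] using this
    · simpa [ha] using hx a
  · rintro ⟨y, t⟩ hx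
    simp only [lbox, Fintype.mem_piFinset, Finset.mem_product] at hx ⊢
    intro b
    have := hx.1 b
    by_cases hb : b = a
    · subst hb; simpa [ha] using hx.2
    · simpa [hb] using this
  · intro x hx; simp
  · rintro ⟨y, t⟩ hx
    simp only [lbox, Fintype.mem_piFinset, Finset.mem_product] at hx
    have := hx.1 a
    simp at this
    simp [← this]
  · intro x hx; simp

lemma lbox_tele {n : ℕ} (N : ℕ) (S : Finset (Fin n)) (a : Fin n) (ha : a ∈ S)
    (h : (Fin n → ℕ) → ℝ) :
    ∑ x ∈ lbox N S, (h (stp a x) - h x) =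
      ∑ y ∈ lbox N (S.erase a), (h y - h (Function.update y a 0)) := by
  rw [lbox_sum N S a ha]
  refine Finset.sum_congr rfl fun y hy => ?_
  have e : ∀ t, stp a (Function.update y a t) = Function.update y a (t + 1) := by
    intro t; funext b
    by_cases hb : b = a
    · subst hb; simp [stp]
    · simp [stp, hb]
  simp_rw [e]
  rw [Finset.sum_range_sub (fun t => h (Function.update y a t))]
  simp only [lbox, Fintype.mem_piFinset] at hy
  have := hy a
  simp at this
  rw [← this]; simp

lemma Om_total {n : ℕ} (F : (Fin n → ℕ) → (Fin n → ℝ)) (N : ℕ)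
    (h0 : ∀ y b, y b = 0 → F y b = 0) (h1 : ∀ y b, y b = N → F y b = 1) (k : ℕ) :
    ∀ (d : Fin k → Fin n), Function.Injective d →
      ∑ x ∈ lbox N (Finset.univ.image d), Om F k d d x = (k.factorial : ℝ) := by
  induction k with
  | zero => intro d _; simp [Om_zero, lbox]
  | succ k ih =>
    intro d hd
    simp_rw [Om_exact_of_closed F k (Om_closed F k)]
    rw [Finset.sum_comm]
    have step : ∀ i' ∈ (Finset.univ : Finset (Fin (k + 1))),
        ∑ x ∈ lbox N (Finset.univ.image d), (-1 : ℝ) ^ (i' : ℕ) *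
          ∑ i : Fin (k + 1), (-1 : ℝ) ^ (i : ℕ) *
        (F (stp (d i) x) (d i') * Om F k (d ∘ i.succAbove) (d ∘ i'.succAbove) (stp (d i) x) -
          F x (d i') * Om F k (d ∘ i.succAbove) (d ∘ i'.succAbove) x) = (k.factorial : ℝ) := by
      intro i' _
      rw [← Finset.mul_sum, Finset.sum_comm]
      simp_rw [← Finset.mul_sum]
      have tele : ∀ i, ∑ x ∈ lbox N (Finset.univ.image d),
          (F (stp (d i) x) (d i') * Om F k (d ∘ i.succAbove) (d ∘ i'.succAbove) (stp (d i) x) -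
          F x (d i') * Om F k (d ∘ i.succAbove) (d ∘ i'.succAbove) x) =
          if i = i' then (k.factorial : ℝ) else 0 := by
        intro i
        rw [lbox_tele N _ (d i) (by simp) (fun x => F x (d i') *
          Om F k (d ∘ i.succAbove) (d ∘ i'.succAbove) x)]
        have hmem : ∀ y ∈ lbox N ((Finset.univ.image d).erase (d i)), y (d i) = N := by
          intro y hy
          simp only [lbox, Fintype.mem_piFinset] at hy
          simpa using hy (d i)
        split_ifs with hi
        · subst hi
          rw [← ih (d ∘ i.succAbove) (hd.comp Fin.succAbove_right_injective)]
          have e : (Finset.univ.image d).erase (d i) = Finset.univ.image (d ∘ i.succAbove) := by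
            ext b
            simp only [Finset.mem_erase, Finset.mem_image, Finset.mem_univ, true_and,
              Function.comp]
            constructor
            · rintro ⟨hb, j, rfl⟩
              obtain ⟨l, hl⟩ := Fin.exists_succAbove_eq (x := j) (y := i) (fun h => hb (by rw [h]))
              exact ⟨l, by rw [hl]⟩
            · rintro ⟨l, rfl⟩
              exact ⟨fun h => Fin.succAbove_ne i l (hd h), _, rfl⟩
          rw [← e]
          refine Finset.sum_congr rfl fun y hy => ?_
          rw [h1 y _ (hmem y hy), h0 (Function.update y (d i) 0) (d i) (by simp)]
          simp
        · obtain ⟨j, hj⟩ := Fin.exists_succAbove_eq hi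
          have hne : ∀ l, (d ∘ i.succAbove) l ≠ d i := fun l h => Fin.succAbove_ne i l (hd h)
          refine Finset.sum_eq_zero fun y hy => ?_
          rw [Om_vanish F (d i) k _ _ y j (by simp [hj]) hne,
            Om_vanish F (d i) k _ _ (Function.update y (d i) 0) j (by simp [hj]) hne]
          · simp
          · intro u v hu hv
            simp only [Function.update_self] at hu hv
            rw [h0 u _ hu, h0 v _ hv]
          · intro u v hu hv
            rw [hmem y hy] at hu hv
            rw [h1 u _ hu, h1 v _ hv]
      simp_rw [tele]
      simp only [mul_ite, mul_zero, Finset.sum_ite_eq', Finset.mem_univ, if_true]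
      rw [← mul_assoc, ← mul_pow]; simp
    rw [Finset.sum_congr rfl step]
    simp [Nat.factorial_succ]

lemma det_diff_zero {n : ℕ} (G : Fin (n + 1) → (Fin n → ℝ)) (a b : Fin (n + 1)) (hab : a < b)
    (h : G a = G b) :
    Matrix.det (Matrix.of fun (j i : Fin n) => (G j.succ - G j.castSucc) i) = 0 := by
  apply Matrix.exists_vecMul_eq_zero_iff.mp
  refine ⟨fun j => if (a : ℕ) ≤ j ∧ (j : ℕ) < b then 1 else 0, ?_, ?_⟩
  · intro h0
    have hl : (a : ℕ) < n := by have := b.2; have : (a : ℕ) < b := hab; omega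
    have := congrFun h0 ⟨a, hl⟩
    have h2 : (a : ℕ) < b := hab
    simp [h2] at this
  · funext i
    let G' : ℕ → ℝ := fun m => if hm : m < n + 1 then G ⟨m, hm⟩ i else 0
    have e1 : ∀ j : Fin n, (if (a : ℕ) ≤ j ∧ (j : ℕ) < b then (1 : ℝ) else 0) *
        (G j.succ - G j.castSucc) i =
        (fun m : ℕ => if (a : ℕ) ≤ m ∧ m < b then G' (m + 1) - G' m else 0) j := by
      intro j
      have h1 : (j : ℕ) < n + 1 := by omega
      have : G' (j + 1) - G' j = (G j.succ - G j.castSucc) i := by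
        simp only [G', Pi.sub_apply]
        rw [dif_pos (by omega), dif_pos h1]
        rfl
      simp only [this]
      split_ifs <;> simp
    simp only [Matrix.vecMul, dotProduct, Matrix.of_apply, Pi.zero_apply]
    rw [Finset.sum_congr rfl (fun j _ => e1 j),
      Fin.sum_univ_eq_sum_range (fun m : ℕ => if (a : ℕ) ≤ m ∧ m < b then G' (m + 1) - G' m else 0),
      ← Finset.sum_filter]
    have e2 : (Finset.range n).filter (fun m => (a : ℕ) ≤ m ∧ m < b) = Finset.Ico (a : ℕ) b := by
      ext m
      have := b.2
      simp only [Finset.mem_filter, Finset.mem_range, Finset.mem_Ico]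
      omega
    rw [e2, Finset.sum_Ico_eq_sub _ (le_of_lt hab), Finset.sum_range_sub, Finset.sum_range_sub]
    simp only [G']
    rw [dif_pos b.2, dif_pos a.2]
    simp [h]

/-- Discrete Lebesgue covering theorem. -/
theorem discrete_lebesgue {n N : ℕ} {α : Type*} (c : (Fin n → ℕ) → α)
    (hc : ∀ (y z : Fin n → ℕ) b, y b = 0 → z b = N → c y ≠ c z) :
    ∃ v : Fin (n + 1) → (Fin n → ℕ), Function.Injective (fun j => c (v j)) ∧
      ∀ j a, v 0 a ≤ v j a ∧ v j a ≤ v 0 a + n := by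
  classical
  let F : (Fin n → ℕ) → (Fin n → ℝ) := fun y b => if ∃ z : Fin n → ℕ, z b = N ∧ c y = c z then 1 else 0
  have tot := Om_total F N (fun y b hy => if_neg (by rintro ⟨z, hz, h⟩; exact hc y z b hy hz h))
    (fun y b hy => if_pos ⟨y, hy, rfl⟩) n id Function.injective_id
  have : ∑ x ∈ lbox N (Finset.univ.image (id : Fin n → Fin n)), Om F n id id x ≠ 0 := by
    rw [tot]; exact_mod_cast Nat.factorial_ne_zero n
  obtain ⟨x, -, hx⟩ := Finset.exists_ne_zero_of_sum_ne_zero this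
  obtain ⟨v, hv0, hv, hM⟩ := gen_path F n _ _ _ hx
  have key : ∀ a b, a < b → c (v a) ≠ c (v b) := by
    intro a b hab h
    exact hM (det_diff_zero (fun j => F (v j)) a b hab (by funext i; simp only [F, h]))
  refine ⟨v, ?_, by rw [hv0]; exact hv⟩
  intro a b h
  rcases lt_trichotomy a b with hlt | hlt | hlt
  · exact (key a b hlt h).elim
  · exact hlt
  · exact (key b a hlt h.symm).elim

/-- coordinates close to integers -/
noncomputable def nearSet {n : ℕ} (t : ℝ) (z : Fin n → ℝ) : Finset (Fin n) :=
  Finset.univ.filter (fun i => |z i - round (z i)| < t)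

/-- thresholds -/
noncomputable def thr (n k : ℕ) : ℝ := ((n : ℝ) - k) / (2 * (n + 1))

lemma kof_ex {n : ℕ} (z : Fin n → ℝ) : ∃ k, n ≤ k + (nearSet (thr n k) z).card := ⟨n, by simp⟩

open Classical in
/-- the colour of a point -/
noncomputable def kof {n : ℕ} (z : Fin n → ℝ) : ℕ := Nat.find (kof_ex z)

/-- the cell of a point -/
noncomputable def cellLabel {n : ℕ} (z : Fin n → ℝ) : Fin n → ℤ := fun i =>
  if |z i - round (z i)| < thr n (kof z) then 2 * round (z i) else 2 * ⌊z i⌋ + 1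

lemma nearSet_subset {n : ℕ} {k : ℕ} (z w : Fin n → ℝ) (hz : kof z = k) (hw : kof w = k)
    (hzw : ∀ i, |z i - w i| < 1 / (2 * ((n : ℝ) + 1))) :
    nearSet (thr n k) w ⊆ nearSet (thr n k) z := by
  classical
  have hz1 : n ≤ k + (nearSet (thr n k) z).card := by
    rw [← hz]; exact Nat.find_spec (kof_ex z)
  rcases k with _ | k
  · have : nearSet (thr n 0) z = Finset.univ := by
      apply Finset.eq_univ_of_card
      refine le_antisymm (Finset.card_le_univ _) ?_
      simpa using hz1
    rw [this]; exact Finset.subset_univ _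
  · have hz2 : ¬ n ≤ k + (nearSet (thr n k) z).card := by
      apply Nat.find_min (kof_ex z)
      have : Nat.find (kof_ex z) = k + 1 := hz
      omega
    have hn : (0 : ℝ) < 2 * ((n : ℝ) + 1) := by positivity
    have hthr : thr n k = thr n (k + 1) + 1 / (2 * ((n : ℝ) + 1)) := by
      unfold thr; push_cast; field_simp; ring
    have hpos : 0 < 1 / (2 * ((n : ℝ) + 1)) := by positivity
    have s1 : nearSet (thr n (k + 1)) z ⊆ nearSet (thr n k) z := by
      intro i
      simp only [nearSet, Finset.mem_filter, Finset.mem_univ, true_and]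
      intro h; linarith
    have s2 : nearSet (thr n (k + 1)) w ⊆ nearSet (thr n k) z := by
      intro i
      simp only [nearSet, Finset.mem_filter, Finset.mem_univ, true_and]
      intro h
      have h1 := round_le (z i) (round (w i))
      have h2 := abs_sub_le (z i) (w i) (round (w i))
      have := hzw i
      linarith
    have : nearSet (thr n (k + 1)) z = nearSet (thr n k) z :=
      Finset.eq_of_subset_of_card_le s1 (by omega)
    rw [this]; exact s2

lemma floor_eq_aux (t δ z w : ℝ) (hδ : δ ≤ t) (hz : t ≤ |z - round z|)
    (h : |z - w| < δ) : ⌊w⌋ ≤ ⌊z⌋ := by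
  by_contra hlt
  push Not at hlt
  have h1 : z < ⌊w⌋ := Int.floor_lt.mp hlt
  have h2 : (⌊w⌋ : ℝ) ≤ w := Int.floor_le w
  have h3 := round_le z ⌊w⌋
  have h4 := round_le w ⌊w⌋
  rw [abs_of_neg (a := z - ⌊w⌋) (by linarith)] at h3
  rw [abs_of_nonneg (a := w - ⌊w⌋) (by linarith)] at h4
  rw [abs_lt] at h
  linarith

lemma cellLabel_eq {n : ℕ} (z w : Fin n → ℝ) (hk : kof z = kof w) (hkn : kof z < n)
    (hzw : ∀ i, |z i - w i| < 1 / (2 * ((n : ℝ) + 1))) : cellLabel z = cellLabel w := by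
  have hwz : ∀ i, |w i - z i| < 1 / (2 * ((n : ℝ) + 1)) := fun i => by
    rw [abs_sub_comm]; exact hzw i
  have hs : nearSet (thr n (kof z)) z = nearSet (thr n (kof z)) w :=
    Finset.Subset.antisymm (nearSet_subset w z hk.symm rfl hwz) (nearSet_subset z w rfl hk.symm hzw)
  have hn : (0 : ℝ) < 2 * ((n : ℝ) + 1) := by positivity
  have hpos : 0 < 1 / (2 * ((n : ℝ) + 1)) := by positivity
  have ht1 : 1 / (2 * ((n : ℝ) + 1)) ≤ thr n (kof z) := by
    unfold thr
    gcongr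
    have : ((kof z : ℝ) + 1) ≤ n := by exact_mod_cast hkn
    linarith
  have ht2 : 2 * thr n (kof z) + 1 / (2 * ((n : ℝ) + 1)) < 1 := by
    have : thr n (kof z) ≤ n / (2 * ((n : ℝ) + 1)) := by
      unfold thr
      gcongr
      simp
    have h2 : 2 * ((n : ℝ) / (2 * ((n : ℝ) + 1))) + 1 / (2 * ((n : ℝ) + 1)) < 1 := by
      rw [← mul_div_assoc, ← add_div, div_lt_one hn]; linarith
    linarith
  funext i
  have hi : |z i - round (z i)| < thr n (kof z) ↔ |w i - round (w i)| < thr n (kof z) := by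
    have := congrArg (fun s => i ∈ s) hs
    simpa [nearSet] using this
  unfold cellLabel
  rw [← hk]
  by_cases h : |z i - round (z i)| < thr n (kof z)
  · rw [if_pos h, if_pos (hi.mp h)]
    have h' := hi.mp h
    have h3 := hzw i
    have : |((round (z i) - round (w i) : ℤ) : ℝ)| < 1 := by
      push_cast
      rw [abs_lt] at *
      constructor <;> linarith
    have : |round (z i) - round (w i)| < 1 := by exact_mod_cast this
    rw [Int.abs_lt_one_iff] at this
    omega
  · have h' : ¬ |w i - round (w i)| < thr n (kof z) := fun hh => h (hi.mpr hh)
    rw [if_neg h, if_neg h']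
    push Not at h h'
    have a1 := floor_eq_aux _ _ _ _ ht1 h (hzw i)
    have a2 := floor_eq_aux _ _ _ _ ht1 h' (hwz i)
    omega

lemma cellLabel_near {n : ℕ} (z : Fin n → ℝ) (i : Fin n) : |z i - (cellLabel z i : ℝ) / 2| ≤ 1 / 2 := by
  unfold cellLabel
  split_ifs with h
  · have := abs_sub_round (z i)
    push_cast
    rw [mul_div_cancel_left₀ _ (by norm_num)]
    exact this
  · have h1 := Int.floor_le (z i)
    have h2 := Int.lt_floor_add_one (z i)
    push_cast
    rw [abs_le]
    constructor <;> linarith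

lemma kof_lt {n : ℕ} (hn : 1 ≤ n) (z : Fin n → ℝ) (h : ∃ i, ∃ m : ℤ, z i = m) : kof z < n := by
  classical
  have : kof z ≤ n - 1 := by
    apply Nat.find_min'
    obtain ⟨i, m, hm⟩ := h
    have : 0 < (nearSet (thr n (n - 1)) z).card := by
      rw [Finset.card_pos]
      refine ⟨i, ?_⟩
      simp only [nearSet, Finset.mem_filter, Finset.mem_univ, true_and, hm, round_intCast, sub_self,
        abs_zero]
      unfold thr
      rw [Nat.cast_sub hn]
      have : (0 : ℝ) < 2 * ((n : ℝ) + 1) := by positivity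
      apply div_pos _ this
      simp
    omega
  omega

lemma cover_of_map {n : ℕ} (hn : 1 ≤ n) {A : Type*} [MetricSpace A] (r : ℝ) (φ : A → (Fin n → ℝ))
    (hint : ∀ a, ∃ i, ∃ m : ℤ, φ a i = m)
    (hlip : ∀ a b, dist a b < 2 * r → dist (φ a) (φ b) < 1 / (2 * ((n : ℝ) + 1)))
    (D : ℝ) (hD : ∀ a b, dist (φ a) (φ b) ≤ 1 → dist a b ≤ D) :
    ∃ U : Set (Set A), ⋃₀ U = univ ∧ (∀ u ∈ U, EMetric.diam u ≤ ENNReal.ofReal D) ∧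
    ∀ x : A, {u ∈ U | (u ∩ Metric.ball x r).Nonempty}.Finite ∧
      {u ∈ U | (u ∩ Metric.ball x r).Nonempty}.ncard ≤ n - 1 + 1 := by
  refine ⟨Set.range (fun m : Fin n → ℤ => {a | cellLabel (φ a) = m}), ?_, ?_, ?_⟩
  · ext a
    simp only [mem_sUnion, mem_univ, iff_true]
    exact ⟨_, ⟨cellLabel (φ a), rfl⟩, rfl⟩
  · rintro _ ⟨m, rfl⟩
    apply Metric.ediam_le
    intro a ha b hb
    rw [edist_dist]
    apply ENNReal.ofReal_le_ofReal
    apply hD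
    rw [dist_pi_le_iff zero_le_one]
    intro i
    have h1 := cellLabel_near (φ a) i
    have h2 := cellLabel_near (φ b) i
    simp only [mem_ofPred_eq] at ha hb
    rw [ha] at h1
    rw [hb] at h2
    rw [Real.dist_eq]
    rw [abs_le] at *
    constructor <;> linarith
  · intro x
    set T := {u ∈ Set.range (fun m : Fin n → ℤ => {a | cellLabel (φ a) = m}) |
      (u ∩ Metric.ball x r).Nonempty} with hT
    have hch : ∀ u : Set A, ∃ a : A, u ∈ T → a ∈ u ∩ Metric.ball x r := by
      intro u
      by_cases hu : u ∈ T
      · obtain ⟨a, ha⟩ := hu.2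
        exact ⟨a, fun _ => ha⟩
      · exact ⟨x, fun h => (hu h).elim⟩
    choose s hs using hch
    have hmap : Set.MapsTo (fun u => kof (φ (s u))) T (Set.Iio n) := by
      intro u hu
      exact kof_lt hn _ (hint _)
    have hinj : Set.InjOn (fun u => kof (φ (s u))) T := by
      intro u hu v hv huv
      have h1 := hs u hu
      have h2 := hs v hv
      obtain ⟨m, rfl⟩ := hu.1
      obtain ⟨m', rfl⟩ := hv.1
      have e1 := h1.1
      have e2 := h2.1
      simp only [mem_ofPred_eq] at e1 e2
      have hd : dist (s {a | cellLabel (φ a) = m}) (s {a | cellLabel (φ a) = m'}) < 2 * r := by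
        have a1 := mem_ball.mp h1.2
        have a2 := mem_ball.mp h2.2
        have := dist_triangle_right (s {a | cellLabel (φ a) = m}) (s {a | cellLabel (φ a) = m'}) x
        linarith
      have := cellLabel_eq _ _ huv (kof_lt hn _ (hint _)) (fun i => by
        rw [← Real.dist_eq]
        exact lt_of_le_of_lt (dist_le_pi_dist _ _ i) (hlip _ _ hd))
      have : m = m' := by rw [← e1, ← e2, this]
      rw [this]
    refine ⟨Set.Finite.of_injOn hmap hinj (Set.finite_Iio n), ?_⟩
    have := Set.ncard_le_ncard_of_injOn _ hmap hinj (Set.finite_Iio n)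
    have h3 : (Set.Iio n).ncard = n := by
      rw [← Finset.coe_Iio, Set.ncard_coe_finset]; simp
    omega

/-- one-dimensional gauge of the interval `[a, a+1]` with centre `p` -/
noncomputable def gau (a p s : ℝ) : ℝ := max ((s - p) / (a + 1 - p)) ((p - s) / (p - a))

lemma gau_bds {a p : ℝ} (hp : |p - (a + 1 / 2)| ≤ 1 / 4) :
    1 / 4 ≤ a + 1 - p ∧ a + 1 - p ≤ 1 ∧ 1 / 4 ≤ p - a ∧ p - a ≤ 1 := by
  rw [abs_le] at hp
  refine ⟨?_, ?_, ?_, ?_⟩ <;> linarith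

lemma gau_ge {a p : ℝ} (hp : |p - (a + 1 / 2)| ≤ 1 / 4) (s : ℝ) : |s - p| ≤ gau a p s := by
  obtain ⟨h1, h2, h3, h4⟩ := gau_bds hp
  unfold gau
  rcases le_total p s with h | h
  · rw [abs_of_nonneg (by linarith)]
    apply le_max_of_le_left
    rw [le_div_iff₀ (by linarith)]
    nlinarith
  · rw [abs_of_nonpos (by linarith)]
    apply le_max_of_le_right
    rw [le_div_iff₀ (by linarith)]
    nlinarith

lemma gau_lip1 (c u : ℝ) (hc : 1 / 4 ≤ c) : |u / c| ≤ 4 * |u| := by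
  rw [abs_div, abs_of_pos (a := c) (by linarith), div_le_iff₀ (by linarith)]
  nlinarith [abs_nonneg u]

lemma gau_lip {a p : ℝ} (hp : |p - (a + 1 / 2)| ≤ 1 / 4) (s t : ℝ) :
    |gau a p s - gau a p t| ≤ 4 * |s - t| := by
  obtain ⟨h1, h2, h3, h4⟩ := gau_bds hp
  unfold gau
  refine (abs_max_sub_max_le_max _ _ _ _).trans (max_le ?_ ?_)
  · rw [← sub_div]
    refine (gau_lip1 _ _ h1).trans (le_of_eq ?_)
    congr 2; ring
  · rw [← sub_div]
    refine (gau_lip1 _ _ h3).trans (le_of_eq ?_)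
    rw [abs_sub_comm s t]
    congr 2; ring

lemma gau_le_one {a p : ℝ} (hp : |p - (a + 1 / 2)| ≤ 1 / 4) (s : ℝ) (h : a ≤ s) (h' : s ≤ a + 1) :
    gau a p s ≤ 1 := by
  obtain ⟨h1, h2, h3, h4⟩ := gau_bds hp
  apply max_le
  · rw [div_le_one (by linarith)]; linarith
  · rw [div_le_one (by linarith)]; linarith

lemma gau_ge_one {a p : ℝ} (hp : |p - (a + 1 / 2)| ≤ 1 / 4) (s : ℝ) (h : s ≤ a ∨ a + 1 ≤ s) :
    1 ≤ gau a p s := by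
  obtain ⟨h1, h2, h3, h4⟩ := gau_bds hp
  rcases h with h | h
  · apply le_max_of_le_right
    rw [le_div_iff₀ (by linarith)]; linarith
  · apply le_max_of_le_left
    rw [le_div_iff₀ (by linarith)]; linarith

lemma gau_hit {a p : ℝ} (hp : |p - (a + 1 / 2)| ≤ 1 / 4) (s : ℝ) (h : 0 < gau a p s) :
    p + (gau a p s)⁻¹ * (s - p) = a ∨ p + (gau a p s)⁻¹ * (s - p) = a + 1 := by
  obtain ⟨h1, h2, h3, h4⟩ := gau_bds hp
  have e1 : a + 1 - p ≠ 0 := by linarith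
  have e2 : p - a ≠ 0 := by linarith
  rcases max_choice ((s - p) / (a + 1 - p)) ((p - s) / (p - a)) with hm | hm
  · right
    unfold gau at h ⊢
    rw [hm] at h ⊢
    have : s - p ≠ 0 := by
      intro h0; rw [h0] at h; simp at h
    field_simp
    ring
  · left
    unfold gau at h ⊢
    rw [hm] at h ⊢
    have : p - s ≠ 0 := by
      intro h0; rw [h0] at h; simp at h
    field_simp
    ring

/-- vector gauge -/
noncomputable def vgau {n : ℕ} (m : Fin n → ℤ) (p x : Fin n → ℝ) : ℝ :=
  ‖fun i => gau (m i) (p i) (x i)‖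

lemma vgau_lip {n : ℕ} (m : Fin n → ℤ) (p : Fin n → ℝ) (hp : ∀ i, |p i - (m i + 1 / 2)| ≤ 1 / 4)
    (x y : Fin n → ℝ) : |vgau m p x - vgau m p y| ≤ 4 * dist x y := by
  refine (abs_norm_sub_norm_le _ _).trans ?_
  rw [pi_norm_le_iff_of_nonneg (by positivity)]
  intro i
  have h1 := gau_lip (hp i) (x i) (y i)
  have h2 := dist_le_pi_dist x y i
  rw [Real.dist_eq] at h2
  simp only [Pi.sub_apply, Real.norm_eq_abs]
  linarith

lemma gau_le_vgau {n : ℕ} (m : Fin n → ℤ) (p x : Fin n → ℝ) (i : Fin n) :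
    gau (m i) (p i) (x i) ≤ vgau m p x :=
  (le_abs_self _).trans (norm_le_pi_norm (fun i => gau (m i) (p i) (x i)) i)

lemma vgau_ge {n : ℕ} (m : Fin n → ℤ) (p : Fin n → ℝ) (hp : ∀ i, |p i - (m i + 1 / 2)| ≤ 1 / 4)
    (x : Fin n → ℝ) : dist x p ≤ vgau m p x := by
  rw [dist_pi_le_iff (show 0 ≤ vgau m p x from norm_nonneg _)]
  intro i
  rw [Real.dist_eq]
  exact (gau_ge (hp i) _).trans (gau_le_vgau m p x i)

lemma vgau_eq {n : ℕ} (hn : 1 ≤ n) (m : Fin n → ℤ) (p : Fin n → ℝ)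
    (hp : ∀ i, |p i - (m i + 1 / 2)| ≤ 1 / 4)
    (x : Fin n → ℝ) : ∃ i, vgau m p x = gau (m i) (p i) (x i) := by
  have : Nonempty (Fin n) := ⟨⟨0, hn⟩⟩
  obtain ⟨i, -, hi⟩ := Finset.exists_max_image Finset.univ (fun i => gau (m i) (p i) (x i))
    Finset.univ_nonempty
  refine ⟨i, le_antisymm ?_ (gau_le_vgau m p x i)⟩
  have h0 : ∀ j, 0 ≤ gau (m j) (p j) (x j) := fun j => (abs_nonneg _).trans (gau_ge (hp j) _)
  unfold vgau
  rw [pi_norm_le_iff_of_nonneg (h0 i)]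
  intro j
  rw [Real.norm_eq_abs, abs_of_nonneg (h0 j)]
  exact hi j (Finset.mem_univ _)

/-- Pushing away from the holes to the walls of the unit cubes. -/
lemma push_exists {n : ℕ} (hn : 1 ≤ n) (p : (Fin n → ℤ) → (Fin n → ℝ))
    (hp : ∀ m i, |p m i - (m i + 1 / 2)| ≤ 1 / 4) (ρ : ℝ) (hρ : 0 < ρ) :
    ∃ φ : (Fin n → ℝ) → (Fin n → ℝ), ∀ x, (∀ m, ρ ≤ dist x (p m)) →
      dist x (φ x) ≤ 1 ∧ (∃ i, ∃ k : ℤ, φ x i = k) ∧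
      ∀ y, (∀ m, ρ ≤ dist y (p m)) → dist (φ x) (φ y) ≤ (5 / ρ + 9) * dist x y := by
  let fl : (Fin n → ℝ) → (Fin n → ℤ) := fun x i => ⌊x i⌋
  let g : (Fin n → ℝ) → ℝ := fun x => vgau (fl x) (p (fl x)) x
  let φ : (Fin n → ℝ) → (Fin n → ℝ) := fun x => p (fl x) + (g x)⁻¹ • (x - p (fl x))
  have hge : ∀ m x, dist x (p m) ≤ vgau m (p m) x := fun m x => vgau_ge m (p m) (hp m) x
  have hle1 : ∀ x, g x ≤ 1 := by
    intro x
    obtain ⟨i, hi⟩ := vgau_eq hn (fl x) (p (fl x)) (hp _) x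
    simp only [g]
    rw [hi]
    exact gau_le_one (hp _ i) _ (Int.floor_le _) (Int.lt_floor_add_one _).le
  have hmove : ∀ x, (∀ m, ρ ≤ dist x (p m)) → dist x (φ x) ≤ 1 - g x := by
    intro x hx
    have hg : 0 < g x := lt_of_lt_of_le hρ ((hx _).trans (hge _ x))
    have e : φ x - x = ((g x)⁻¹ - 1) • (x - p (fl x)) := by
      simp only [φ, sub_smul, one_smul]; abel
    have h1 : 1 ≤ (g x)⁻¹ := (one_le_inv₀ hg).mpr (hle1 x)
    rw [dist_comm, dist_eq_norm, e, norm_smul, Real.norm_eq_abs, abs_of_nonneg (by linarith),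
      ← dist_eq_norm]
    calc ((g x)⁻¹ - 1) * dist x (p (fl x)) ≤ ((g x)⁻¹ - 1) * g x :=
          mul_le_mul_of_nonneg_left (hge _ x) (by linarith)
      _ = 1 - g x := by rw [sub_mul, inv_mul_cancel₀ hg.ne']; ring
  have hdiff : ∀ x y, fl x ≠ fl y → 1 - g x ≤ 4 * dist x y := by
    intro x y hxy
    obtain ⟨i, hi⟩ := Function.ne_iff.mp hxy
    have h1 : 1 ≤ vgau (fl x) (p (fl x)) y := by
      refine le_trans ?_ (gau_le_vgau _ _ _ i)
      apply gau_ge_one (hp _ i)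
      rcases lt_or_gt_of_ne hi with h | h
      · right
        have : (⌊x i⌋ : ℤ) + 1 ≤ ⌊y i⌋ := h
        have := Int.le_floor.mp this
        push_cast at this
        exact this
      · left
        exact (Int.floor_lt.mp h).le
    have h2 := vgau_lip (fl x) (p (fl x)) (hp _) x y
    rw [abs_le] at h2
    simp only [g]
    linarith
  refine ⟨φ, fun x hx => ⟨?_, ?_, ?_⟩⟩
  · have h1 := hmove x hx
    have hg : 0 ≤ g x := norm_nonneg _
    linarith
  · have hg : 0 < g x := lt_of_lt_of_le hρ ((hx _).trans (hge _ x))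
    obtain ⟨i, hi⟩ := vgau_eq hn (fl x) (p (fl x)) (hp _) x
    have hgi : g x = gau (fl x i) (p (fl x) i) (x i) := hi
    refine ⟨i, ?_⟩
    have := gau_hit (hp (fl x) i) (x i) (by rw [← hgi]; exact hg)
    rw [← hgi] at this
    rcases this with h | h
    · exact ⟨fl x i, h⟩
    · exact ⟨fl x i + 1, by push_cast; exact h⟩
  · intro y hy
    have hgx : ρ ≤ g x := (hx _).trans (hge _ x)
    have hgy : ρ ≤ g y := (hy _).trans (hge _ y)
    have d0 : 0 ≤ dist x y := dist_nonneg
    by_cases hxy : fl x = fl y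
    · have e : φ x - φ y = (g x)⁻¹ • (x - y) + ((g x)⁻¹ - (g y)⁻¹) • (y - p (fl y)) := by
        simp only [φ, hxy, sub_smul, smul_sub]; abel
      have hl : |g x - g y| ≤ 4 * dist x y := by
        have := vgau_lip (fl x) (p (fl x)) (hp _) x y
        simp only [g]
        rw [← hxy]
        exact this
      have i1 : (g x)⁻¹ ≤ ρ⁻¹ := inv_anti₀ hρ hgx
      have px : 0 < g x := by linarith
      have py : 0 < g y := by linarith
      have t2 : |(g x)⁻¹ - (g y)⁻¹| * dist y (p (fl y)) ≤ ρ⁻¹ * (4 * dist x y) := by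
        calc |(g x)⁻¹ - (g y)⁻¹| * dist y (p (fl y)) ≤ |(g x)⁻¹ - (g y)⁻¹| * g y :=
              mul_le_mul_of_nonneg_left (hge _ y) (abs_nonneg _)
          _ = (g x)⁻¹ * |g x - g y| := by
              rw [inv_sub_inv px.ne' py.ne', abs_div, abs_of_pos (mul_pos px py), abs_sub_comm]
              field_simp
          _ ≤ ρ⁻¹ * (4 * dist x y) := by gcongr
      rw [dist_eq_norm (φ x), e]
      refine (norm_add_le _ _).trans ?_
      rw [norm_smul, norm_smul, Real.norm_eq_abs,
        Real.norm_eq_abs, ← dist_eq_norm x y, ← dist_eq_norm y, abs_of_pos (inv_pos.mpr px)]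
      have t1 : (g x)⁻¹ * dist x y ≤ ρ⁻¹ * dist x y := by gcongr
      have : (5 / ρ + 9) * dist x y = ρ⁻¹ * dist x y + ρ⁻¹ * (4 * dist x y) + 9 * dist x y := by
        rw [div_eq_mul_inv]; ring
      rw [this]
      linarith
    · have h1 := (hmove x hx).trans (hdiff x y hxy)
      have h2 := (hmove y hy).trans (hdiff y x (Ne.symm hxy))
      rw [dist_comm y x] at h2
      have h3 := dist_triangle4 (φ x) x y (φ y)
      rw [dist_comm (φ x) x] at h3
      have : 0 ≤ 5 / ρ * dist x y := by positivity
      nlinarith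

lemma holes_of_small {n : ℕ} {X : Type*} [MetricSpace X] (f : X → (Fin n → ℝ))
    (hf : IsCoarseEquiv f) (A : Set X) (hA : IsSmall A) (r' : ℝ) (hr' : 0 < r') :
    ∃ R' > (0 : ℝ), ∀ z, ∃ w, dist w z ≤ R' ∧ ∀ a ∈ A, r' ≤ dist (f a) w := by
  obtain ⟨hfc, g, hgc, ⟨C1, h1⟩, ⟨C2, h2⟩⟩ := hf
  obtain ⟨S, hS, hgS⟩ := hgc r' hr'
  set r : ℝ := S + 2 * |C1| + 1 with hr
  have hrpos : 0 < r := by positivity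
  have hL : IsLarge {x | x ∈ A ∨ ∀ a ∈ A, r ≤ dist x a} := by
    refine ⟨r, hrpos, fun x => ?_⟩
    by_cases h : ∀ a ∈ A, r ≤ dist x a
    · exact ⟨x, Or.inr h, by simpa using hrpos⟩
    · push Not at h
      obtain ⟨a, ha, hxa⟩ := h
      exact ⟨a, Or.inl ha, hxa⟩
  obtain ⟨R, hR, hRx⟩ := hA _ hL
  obtain ⟨S', hS', hfS⟩ := hfc R hR
  refine ⟨S' + |C2|, by positivity, fun z => ?_⟩
  obtain ⟨y, ⟨hy, hyA⟩, hd⟩ := hRx (g z)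
  have hy' : ∀ a ∈ A, r ≤ dist y a := hy.resolve_left hyA
  refine ⟨f y, ?_, fun a ha => ?_⟩
  · have a1 := hfS _ _ hd.le
    have a2 := h2 z
    have a3 := dist_triangle (f y) (f (g z)) z
    rw [dist_comm (f y) (f (g z)), dist_comm (f (g z)) z] at a3
    have := le_abs_self C2
    linarith
  · by_contra hlt
    push Not at hlt
    have a1 := hgS _ _ hlt.le
    have a2 := hy' a ha
    have a3 := dist_triangle4 a (g (f a)) (g (f y)) y
    have a4 := h1 a
    have a5 := h1 y
    rw [dist_comm (g (f y)) y, dist_comm a y] at a3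
    have := le_abs_self C1
    linarith

lemma asdim_of_small {n : ℕ} (hn : 1 ≤ n) {X : Type*} [MetricSpace X] (f : X → (Fin n → ℝ))
    (hf : IsCoarseEquiv f) (A : Set X) (hA : IsSmall A) : AsdimLE ↥A (n - 1) := by
  intro r hr
  have hf' := hf
  obtain ⟨hfc, g, hgc, ⟨C1, h1⟩, ⟨C2, h2⟩⟩ := hf'
  obtain ⟨S, hS, hfS⟩ := hfc (2 * r) (by positivity)
  set δ : ℝ := 1 / (2 * ((n : ℝ) + 1)) with hδ
  have hδpos : 0 < δ := by positivity
  set r' : ℝ := 20 * S / δ with hr'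
  have hr'pos : 0 < r' := by positivity
  obtain ⟨R', hR', hw⟩ := holes_of_small f hf A hA r' hr'pos
  choose w hw1 hw2 using hw
  set l : ℝ := 4 * R' + 36 * S / δ with hl
  have hlpos : 0 < l := by positivity
  let p : (Fin n → ℤ) → (Fin n → ℝ) := fun m => l⁻¹ • w (fun i => l * (m i + 1 / 2))
  have hp : ∀ m i, |p m i - (m i + 1 / 2)| ≤ 1 / 4 := by
    intro m i
    have a1 := (dist_le_pi_dist _ _ i).trans (hw1 (fun i => l * (m i + 1 / 2)))
    rw [Real.dist_eq] at a1
    have e : p m i - (m i + 1 / 2) =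
        (w (fun i => l * (m i + 1 / 2)) i - l * (m i + 1 / 2)) / l := by
      simp only [p, Pi.smul_apply, smul_eq_mul]
      generalize w _ i = q
      field_simp
    rw [e, abs_div, abs_of_pos hlpos, div_le_iff₀ hlpos]
    have : 0 < 36 * S / δ := by positivity
    linarith
  set ρ : ℝ := r' / l with hρ
  have hρpos : 0 < ρ := by positivity
  obtain ⟨φ, hφ⟩ := push_exists hn p hp ρ hρpos
  have hfar : ∀ a : A, ∀ m, ρ ≤ dist (l⁻¹ • f a) (p m) := by
    intro a m
    simp only [p]
    rw [dist_smul₀, Real.norm_eq_abs, abs_of_pos (inv_pos.mpr hlpos), hρ, div_eq_inv_mul]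
    exact mul_le_mul_of_nonneg_left (hw2 _ a a.2) (inv_pos.mpr hlpos).le
  have hsc : ∀ a b : A, dist (l⁻¹ • f a) (l⁻¹ • f b) = dist (f a) (f b) / l := by
    intro a b
    rw [dist_smul₀, Real.norm_eq_abs, abs_of_pos (inv_pos.mpr hlpos), div_eq_inv_mul]
  obtain ⟨S2, hS2, hgS⟩ := hgc (3 * l) (by positivity)
  refine ⟨S2 + 2 * |C1|, by positivity, cover_of_map hn r (fun a : A => φ (l⁻¹ • f a)) ?_ ?_ _ ?_⟩
  · intro a; exact (hφ _ (hfar a)).2.1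
  · intro a b hab
    have a1 := (hφ _ (hfar a)).2.2 _ (hfar b)
    rw [hsc] at a1
    have a2 : dist (f a) (f b) ≤ S := hfS _ _ (by rw [← Subtype.dist_eq]; exact hab.le)
    have a3 : (5 / ρ + 9) * (dist (f a) (f b) / l) ≤ (5 / ρ + 9) * (S / l) := by gcongr
    have a4 : (5 / ρ + 9) * (S / l) = δ / 4 + 9 * S / l := by
      rw [hρ, hr']; field_simp; ring
    have a5 : 9 * S / l ≤ δ / 4 := by
      rw [div_le_iff₀ hlpos, hl]
      have : δ / 4 * (4 * R' + 36 * S / δ) = δ * R' + 9 * S := by field_simp; ring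
      rw [this]
      have : 0 < δ * R' := by positivity
      linarith
    linarith
  · intro a b hab
    have a1 := (hφ _ (hfar a)).1
    have a2 := (hφ _ (hfar b)).1
    have a3 := dist_triangle4 (l⁻¹ • f a) (φ (l⁻¹ • f a)) (φ (l⁻¹ • f b)) (l⁻¹ • f b)
    rw [dist_comm (φ (l⁻¹ • f b)) _, hsc] at a3
    have a4 : dist (f a) (f b) / l ≤ 3 := by linarith
    rw [div_le_iff₀ hlpos] at a4
    have b1 := hgS _ _ a4
    have b2 := dist_triangle4 (a : X) (g (f a)) (g (f b)) b
    have b3 := h1 a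
    have b4 := h1 b
    rw [dist_comm (g (f b)) _] at b2
    have := le_abs_self C1
    rw [Subtype.dist_eq]
    linarith

lemma small_of_asdim {n : ℕ} (hn : 1 ≤ n) {X : Type*} [MetricSpace X] (f : X → (Fin n → ℝ))
    (hf : IsCoarseEquiv f) (A : Set X) (hA : AsdimLE ↥A (n - 1)) : IsSmall A := by
  obtain ⟨hfc, g, hgc, ⟨C1, h1⟩, ⟨C2, h2⟩⟩ := hf
  rintro L ⟨r, hr, hL⟩
  by_contra hnot
  obtain ⟨Sn, hSn, hgn⟩ := hgc n (by exact_mod_cast hn)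
  set ρ : ℝ := Sn + 2 * r + 1 with hρ
  obtain ⟨D, hD, U, hU1, hU2, hU3⟩ := hA ρ (by positivity)
  obtain ⟨Sf, hSf, hfS⟩ := hfc (D + 2 * r) (by positivity)
  obtain ⟨N, hN⟩ := exists_nat_gt (Sf + 2 * |C2|)
  have hNpos : (0 : ℝ) < N := lt_of_le_of_lt (by positivity) hN
  obtain ⟨SN, hSN, hgN⟩ := hgc N hNpos
  have hx : ∃ x : X, ∀ y ∈ L \ A, SN + |C1| + r ≤ dist x y := by
    by_contra hc
    push Not at hc
    exact hnot ⟨SN + |C1| + r, by positivity, hc⟩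
  obtain ⟨x0, hx0⟩ := hx
  let cl : (Fin n → ℕ) → (Fin n → ℕ) := fun y i => min (y i) N
  let h : (Fin n → ℕ) → (Fin n → ℝ) := fun y i => f x0 i + (cl y i : ℝ)
  have hclose : ∀ y, ∃ a : A, dist (g (h y)) a < r := by
    intro y
    obtain ⟨a, haL, had⟩ := hL (g (h y))
    by_cases haA : a ∈ A
    · exact ⟨⟨a, haA⟩, had⟩
    · exfalso
      have a1 := hx0 a ⟨haL, haA⟩
      have a2 : dist (f x0) (h y) ≤ N := by
        rw [dist_pi_le_iff hNpos.le]
        intro i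
        simp only [h, cl, dist_self_add_right, Real.norm_eq_abs, Nat.abs_cast]
        exact_mod_cast min_le_right _ _
      have a3 := hgN _ _ a2
      have a4 := dist_triangle4 x0 (g (f x0)) (g (h y)) a
      have a5 := h1 x0
      have := le_abs_self C1
      linarith
  choose α hα using hclose
  have hcov : ∀ a : A, ∃ u ∈ U, a ∈ u := by
    intro a
    have : a ∈ ⋃₀ U := by rw [hU1]; trivial
    exact this
  choose c hcU hc using hcov
  have hadist : ∀ y z, dist (g (h y)) (g (h z)) ≤ dist (α y) (α z) + 2 * r := by
    intro y z
    have a1 := dist_triangle4 (g (h y)) (α y) (α z) (g (h z))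
    have a2 := hα y
    have a3 := hα z
    rw [dist_comm (α z : X) _] at a1
    rw [Subtype.dist_eq]
    linarith
  have hadist' : ∀ y z, dist (α y) (α z) ≤ dist (g (h y)) (g (h z)) + 2 * r := by
    intro y z
    have a1 := dist_triangle4 (α y : X) (g (h y)) (g (h z)) (α z)
    have a2 := hα y
    have a3 := hα z
    rw [dist_comm (α y : X) (g (h y))] at a1
    rw [Subtype.dist_eq]
    linarith
  obtain ⟨v, hvinj, hv⟩ := discrete_lebesgue (n := n) (N := N) (fun y => c (α y)) (by
    intro y z b hy hz heq
    have m1 := hc (α y)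
    have m2 := hc (α z)
    rw [← heq] at m2
    have a1 := (Metric.edist_le_ediam_of_mem m1 m2).trans (hU2 _ (hcU _))
    rw [edist_dist, ENNReal.ofReal_le_ofReal_iff hD.le] at a1
    have a2 := hfS _ _ ((hadist y z).trans (by linarith))
    have a3 := dist_triangle4 (h y) (f (g (h y))) (f (g (h z))) (h z)
    have a4 := h2 (h y)
    have a5 := h2 (h z)
    rw [dist_comm (f (g (h z))) (h z)] at a3
    have a6 := dist_le_pi_dist (h y) (h z) b
    have a7 : dist (h y b) (h z b) = N := by
      simp [h, cl, hy, hz]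
    have := le_abs_self C2
    linarith)
  have hsub : Set.range (fun j => c (α (v j))) ⊆
      {u ∈ U | (u ∩ Metric.ball (α (v 0)) ρ).Nonempty} := by
    rintro _ ⟨j, rfl⟩
    refine ⟨hcU _, α (v j), hc _, ?_⟩
    rw [mem_ball]
    have a1 := hadist' (v j) (v 0)
    have a2 : dist (h (v j)) (h (v 0)) ≤ n := by
      rw [dist_pi_le_iff (by positivity)]
      intro i
      simp only [h, cl, dist_add_left]
      rw [Real.dist_eq, abs_le]
      obtain ⟨b1, b2⟩ := hv j i
      have c1 : min (v 0 i) N ≤ min (v j i) N := by omega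
      have c2 : min (v j i) N ≤ min (v 0 i) N + n := by omega
      have c1' : ((min (v 0 i) N : ℕ) : ℝ) ≤ (min (v j i) N : ℕ) := by exact_mod_cast c1
      have c2' : ((min (v j i) N : ℕ) : ℝ) ≤ (min (v 0 i) N : ℕ) + n := by exact_mod_cast c2
      have : (0 : ℝ) ≤ n := by positivity
      constructor <;> linarith
    have a3 := hgn _ _ a2
    linarith
  obtain ⟨hfin, hcard⟩ := hU3 (α (v 0))
  have k1 := Set.ncard_le_ncard hsub hfin
  have k2 : (Set.range (fun j => c (α (v j)))).ncard = n + 1 := by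
    rw [← Set.image_univ, Set.ncard_image_of_injective _ hvinj, Set.ncard_univ]
    simp
  omega

theorem small_iff_asdim_lt_of_coarseEquiv_euclidean (n : ℕ) (hn : 1 ≤ n)
    {X : Type*} [MetricSpace X] (f : X → (Fin n → ℝ)) (hf : IsCoarseEquiv f) (A : Set X) :
    IsSmall A ↔ AsdimLE ↥A (n - 1) :=
  ⟨asdim_of_small hn f hf A, small_of_asdim hn f hf A⟩
end

section
/- Let G be an abelian group equipped with a proper left-invariant metric. If G is generated (as a group) by a compact subset, then there exists n ∈ ℕ such that G is coarsely equivalent to ℝ^n (Fin n → ℝ with the sup-metric). -/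
open Metric Set

/-- The homomorphism from `ℤ^n` determined by `n` elements of a commutative group. -/
def wordMap {G : Type*} [CommGroup G] {n : ℕ} (a : Fin n → G) (v : Fin n → ℤ) : G :=
  ∏ i, a i ^ v i

theorem wordMap_add {G : Type*} [CommGroup G] {n : ℕ} (a : Fin n → G) (v w : Fin n → ℤ) :
    wordMap a (v + w) = wordMap a v * wordMap a w := by
  simp [wordMap, zpow_add, Finset.prod_mul_distrib]

theorem wordMap_neg {G : Type*} [CommGroup G] {n : ℕ} (a : Fin n → G) (v : Fin n → ℤ) :
    wordMap a (-v) = (wordMap a v)⁻¹ := by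
  simp [wordMap]

theorem wordMap_sub {G : Type*} [CommGroup G] {n : ℕ} (a : Fin n → G) (v w : Fin n → ℤ) :
    wordMap a (v - w) = wordMap a v * (wordMap a w)⁻¹ := by
  rw [sub_eq_add_neg, wordMap_add, wordMap_neg]

theorem wordMap_zero {G : Type*} [CommGroup G] {n : ℕ} (a : Fin n → G) :
    wordMap a 0 = 1 := by
  simp [wordMap]

section metric
variable {G : Type*} [CommGroup G] [MetricSpace G]

theorem li_mul (hinv : ∀ z x y : G, dist (z * x) (z * y) = dist x y) (x x' y y' : G) :
    dist (x * y) (x' * y') ≤ dist x x' + dist y y' := by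
  have h1 : dist (x * y) (x' * y) = dist x x' := by
    rw [mul_comm x, mul_comm x', hinv]
  have h2 := hinv x' y y'
  have := dist_triangle (x * y) (x' * y) (x' * y')
  linarith

theorem li_inv (hinv : ∀ z x y : G, dist (z * x) (z * y) = dist x y) (x y : G) :
    dist x⁻¹ y⁻¹ = dist x y := by
  rw [← hinv (x * y) x⁻¹ y⁻¹, dist_comm x y]
  congr 1
  · rw [mul_comm x y]; simp
  · simp

theorem li_div (hinv : ∀ z x y : G, dist (z * x) (z * y) = dist x y) (x y : G) :
    dist (x * y⁻¹) 1 = dist x y := by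
  rw [← hinv y (x * y⁻¹) 1]
  congr 1
  · rw [mul_comm x, mul_inv_cancel_left]
  · simp

theorem ball_cover (hproper : ∀ (x : G) (R : ℝ), IsCompact (Metric.closedBall x R))
    (R e : ℝ) (he : 0 < e) :
    ∃ t : Set G, t.Finite ∧ ∀ x : G, dist x 1 ≤ R → ∃ y ∈ t, dist x y < e := by
  obtain ⟨t, -, ht, hc⟩ := (hproper 1 R).finite_cover_balls he
  refine ⟨t, ht, fun x hx => ?_⟩
  have := hc (Metric.mem_closedBall.2 hx)
  simpa using this

end metric

/-- An abstract form of Weil's dichotomy for monothetic groups: recurrence implies boundedness. -/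
theorem recurrent_bounded (P : ℝ → ℤ → Prop)
    (hmono : ∀ r s i, r ≤ s → P r i → P s i)
    (hadd : ∀ r s i j, P r i → P s j → P (r + s) (i + j))
    (hneg : ∀ r i, P r i → P r (-i))
    (hex : ∀ i, ∃ r, P r i) (hzero : P 0 0)
    (htb : ∀ R, ∃ F : Set ℤ, F.Finite ∧ ∀ j, P R j → ∃ l ∈ F, P 1 (j - l))
    (R : ℝ) (hinf : {j | P R j}.Infinite) : ∃ C, ∀ k, P C k := by
  have hinf1 : {j | P 1 j}.Infinite := by
    intro hfin
    obtain ⟨F, hF, hc⟩ := htb R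
    apply hinf
    refine (hfin.image2 (fun x y => x + y) hF).subset ?_
    intro j hj
    obtain ⟨l, hl, hp⟩ := hc j hj
    exact ⟨j - l, hp, l, hl, by simp⟩
  obtain ⟨F, hF, hc⟩ := htb 2
  obtain ⟨B, hB⟩ : ∃ B : ℤ, ∀ l ∈ F, |l| ≤ B := by
    obtain ⟨B, hB⟩ := (hF.image (fun l => |l|)).bddAbove
    exact ⟨B, fun l hl => hB ⟨l, hl, rfl⟩⟩
  obtain ⟨M, hM, hMB⟩ : ∃ M : ℤ, P 1 M ∧ B < M := by
    by_contra! hcon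
    apply hinf1
    refine (Set.finite_Icc (-B) B).subset ?_
    intro j hj
    have h1 := hcon j hj
    have h2 := hcon (-j) (hneg 1 j hj)
    exact ⟨by linarith, h1⟩
  have step : ∀ j, P 1 j → ∃ j', P 1 j' ∧ j < j' ∧ j' ≤ j + 2 * M := by
    intro j hj
    have h2 : P 2 (j + M) := by
      have := hadd 1 1 j M hj hM
      norm_num at this
      exact this
    obtain ⟨l, hl, hp⟩ := hc _ h2
    have := abs_le.1 (hB l hl)
    exact ⟨j + M - l, hp, by linarith, by linarith⟩
  have near : ∀ k : ℕ, ∃ j : ℤ, P 1 j ∧ j ≤ k ∧ (k : ℤ) ≤ j + 2 * M := by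
    have hM0 : 0 ≤ 2 * M := by
      obtain ⟨j', -, h1, h2⟩ := step 0 (hmono 0 1 0 zero_le_one hzero)
      linarith
    intro k
    induction k with
    | zero => exact ⟨0, hmono 0 1 0 zero_le_one hzero, by simp, by simpa using hM0⟩
    | succ k ih =>
      obtain ⟨j, hj, h1, h2⟩ := ih
      obtain ⟨j', hj', h3, h4⟩ := step j hj
      by_cases h : j' ≤ k + 1
      · exact ⟨j', hj', by push_cast; linarith, by push_cast; omega⟩
      · exact ⟨j, hj, by push_cast; linarith, by push_cast; omega⟩
  choose r hr using hex
  obtain ⟨C, hC⟩ := ((Set.finite_Icc 0 (2 * M)).image r).bddAbove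
  have pos : ∀ k : ℕ, P (1 + C) k := by
    intro k
    obtain ⟨j, hj, h1, h2⟩ := near k
    have h3 : P C (k - j) := by
      refine hmono (r (k - j)) C _ (hC ⟨_, ⟨by linarith, by linarith⟩, rfl⟩) (hr _)
    have := hadd _ _ _ _ hj h3
    simpa using this
  refine ⟨1 + C, fun k => ?_⟩
  obtain ⟨m, rfl | rfl⟩ := k.eq_nat_or_neg
  · exact pos m
  · exact hneg _ _ (pos m)

theorem recurrent_bounded_metric {G : Type*} [CommGroup G] [MetricSpace G]
    (hinv : ∀ z x y : G, dist (z * x) (z * y) = dist x y)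
    (hproper : ∀ (x : G) (R : ℝ), IsCompact (Metric.closedBall x R))
    {n : ℕ} (a : Fin n → G) (b : G) (R : ℝ)
    (hinf : {j : ℤ | ∃ w, dist (b ^ j) (wordMap a w) ≤ R}.Infinite) :
    ∃ C : ℝ, ∀ k : ℤ, ∃ w, dist (b ^ k) (wordMap a w) ≤ C := by
  refine recurrent_bounded (fun r j => ∃ w, dist (b ^ j) (wordMap a w) ≤ r) ?_ ?_ ?_ ?_ ?_ ?_ R hinf
  · rintro r s i h ⟨w, hw⟩
    exact ⟨w, hw.trans h⟩
  · rintro r s i j ⟨w, hw⟩ ⟨w', hw'⟩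
    refine ⟨w + w', ?_⟩
    rw [zpow_add, wordMap_add]
    exact (li_mul hinv _ _ _ _).trans (add_le_add hw hw')
  · rintro r i ⟨w, hw⟩
    refine ⟨-w, ?_⟩
    rw [zpow_neg, wordMap_neg, li_inv hinv]
    exact hw
  · intro i
    exact ⟨_, 0, le_rfl⟩
  · exact ⟨0, by simp [wordMap_zero]⟩
  · intro R
    obtain ⟨t, ht, hc⟩ := ball_cover hproper R (1 / 2) (by norm_num)
    let Q : G → ℤ → Prop := fun y j => ∃ w, dist (b ^ j * (wordMap a w)⁻¹) y < 1 / 2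
    classical
    let s : G → ℤ := fun y => if h : ∃ j, Q y j then h.choose else 0
    refine ⟨s '' t, ht.image s, ?_⟩
    rintro j ⟨w, hw⟩
    obtain ⟨y, hy, hd⟩ := hc (b ^ j * (wordMap a w)⁻¹) (by rw [li_div hinv]; exact hw)
    have hQ : ∃ j, Q y j := ⟨j, w, hd⟩
    have hs : Q y (s y) := by
      simp only [s, dif_pos hQ]
      exact hQ.choose_spec
    obtain ⟨w', hw'⟩ := hs
    refine ⟨s y, ⟨y, hy, rfl⟩, w - w', ?_⟩
    have h1 : dist (b ^ j * (wordMap a w)⁻¹) (b ^ (s y) * (wordMap a w')⁻¹) ≤ 1 := by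
      have := dist_triangle_right (b ^ j * (wordMap a w)⁻¹) (b ^ (s y) * (wordMap a w')⁻¹) y
      linarith
    rw [← li_div hinv] at h1 ⊢
    convert h1 using 2
    rw [wordMap_sub, zpow_sub]
    simp only [mul_inv, inv_inv]
    simp only [mul_assoc, mul_left_comm, mul_comm]

theorem exists_cobounded {G : Type*} [CommGroup G] [MetricSpace G]
    (hinv : ∀ z x y : G, dist (z * x) (z * y) = dist x y)
    (hproper : ∀ (x : G) (R : ℝ), IsCompact (Metric.closedBall x R))
    (hgen : ∃ K : Set G, IsCompact K ∧ Subgroup.closure K = ⊤) :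
    ∃ n : ℕ, ∃ a : Fin n → G, ∃ C : ℝ, ∀ x, ∃ v, dist x (wordMap a v) ≤ C := by
  obtain ⟨K, hK, hgen⟩ := hgen
  obtain ⟨R0, hR0⟩ := hK.isBounded.subset_closedBall 1
  let R := max R0 1
  have hR : 0 < R := lt_of_lt_of_le one_pos (le_max_right _ _)
  obtain ⟨t, ht, hc⟩ := ball_cover hproper (R + R) R hR
  obtain ⟨n, a, -, ha⟩ := ht.fin_param
  have hword : ∀ i, wordMap a (Pi.single i 1) = a i := by
    intro i
    unfold wordMap
    rw [Finset.prod_eq_single i]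
    · simp
    · intro j _ hj
      simp [hj]
    · simp
  refine ⟨n, a, R, fun x => ?_⟩
  have hx : x ∈ Subgroup.closure K := by rw [hgen]; trivial
  induction hx using Subgroup.closure_induction with
  | mem x hx =>
    refine ⟨0, ?_⟩
    rw [wordMap_zero]
    exact (Metric.mem_closedBall.1 (hR0 hx)).trans (le_max_left _ _)
  | one => exact ⟨0, by rw [wordMap_zero, dist_self]; exact hR.le⟩
  | mul x y _ _ hx hy =>
    obtain ⟨v, hv⟩ := hx
    obtain ⟨w, hw⟩ := hy
    have h1 := (li_mul hinv _ _ _ _).trans (add_le_add hv hw)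
    rw [← wordMap_add, ← li_div hinv] at h1
    obtain ⟨z, hz, hd⟩ := hc _ h1
    rw [← ha] at hz
    obtain ⟨i, rfl⟩ := hz
    refine ⟨(v + w) + Pi.single i 1, ?_⟩
    rw [wordMap_add, hword]
    rw [← hinv (wordMap a (v + w))] at hd
    rw [mul_comm (x * y), mul_inv_cancel_left] at hd
    exact hd.le
  | inv x _ hx =>
    obtain ⟨v, hv⟩ := hx
    exact ⟨-v, by rw [wordMap_neg, li_inv hinv]; exact hv⟩

theorem exists_reduce {G : Type*} [CommGroup G] [MetricSpace G]
    (hinv : ∀ z x y : G, dist (z * x) (z * y) = dist x y)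
    (hproper : ∀ (x : G) (R : ℝ), IsCompact (Metric.closedBall x R))
    {n : ℕ} (a : Fin (n + 1) → G) (C : ℝ) (hC : ∀ x, ∃ v, dist x (wordMap a v) ≤ C)
    (R : ℝ) (hinf : {v | dist (wordMap a v) 1 ≤ R}.Infinite) :
    ∃ a' : Fin n → G, ∃ C' : ℝ, ∀ x, ∃ v, dist x (wordMap a' v) ≤ C' := by
  obtain ⟨i, hi⟩ : ∃ i, ((fun v : Fin (n + 1) → ℤ => v i) '' {v | dist (wordMap a v) 1 ≤ R}).Infinite := by
    by_contra! hcon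
    apply hinf
    refine (Set.Finite.pi' (t := fun i => (fun v : Fin (n + 1) → ℤ => v i) '' {v | dist (wordMap a v) 1 ≤ R}) ?_).subset ?_
    · intro i
      simpa using hcon i
    · intro v hv i
      exact ⟨v, hv, rfl⟩
  let a' : Fin n → G := fun j => a (i.succAbove j)
  have hsplit : ∀ v, wordMap a v = a i ^ v i * wordMap a' (fun j => v (i.succAbove j)) := by
    intro v
    exact Fin.prod_univ_succAbove _ i
  obtain ⟨D, hD⟩ := recurrent_bounded_metric hinv hproper a' (a i) R (by
    refine hi.mono ?_
    rintro _ ⟨v, hv, rfl⟩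
    refine ⟨-(fun j => v (i.succAbove j)), ?_⟩
    rw [← li_div hinv, wordMap_neg, inv_inv, ← hsplit]
    exact hv)
  refine ⟨a', C + D, fun x => ?_⟩
  obtain ⟨v, hv⟩ := hC x
  obtain ⟨w, hw⟩ := hD (v i)
  refine ⟨w + (fun j => v (i.succAbove j)), (dist_triangle _ _ _).trans (add_le_add hv ?_)⟩
  rw [hsplit, wordMap_add]
  refine (li_mul hinv _ _ _ _).trans ?_
  simpa using hw

theorem exists_lattice {G : Type*} [CommGroup G] [MetricSpace G]
    (hinv : ∀ z x y : G, dist (z * x) (z * y) = dist x y)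
    (hproper : ∀ (x : G) (R : ℝ), IsCompact (Metric.closedBall x R))
    (hgen : ∃ K : Set G, IsCompact K ∧ Subgroup.closure K = ⊤) :
    ∃ n : ℕ, ∃ a : Fin n → G, (∃ C : ℝ, ∀ x, ∃ v, dist x (wordMap a v) ≤ C) ∧
      ∀ R : ℝ, {v | dist (wordMap a v) 1 ≤ R}.Finite := by
  classical
  have h := exists_cobounded hinv hproper hgen
  obtain ⟨a, C, hC⟩ := Nat.find_spec h
  have hmin := fun m => Nat.find_min h (m := m)
  generalize Nat.find h = n at *
  refine ⟨n, a, ⟨C, hC⟩, fun R => ?_⟩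
  by_contra hinf
  cases n with
  | zero => exact hinf (Set.toFinite _)
  | succ n => exact hmin n (Nat.lt_succ_self n) (exists_reduce hinv hproper a C hC R hinf)

theorem compactly_generated_abelian_coarseEquiv_euclidean (G : Type*) [CommGroup G]
    [MetricSpace G]
    (hinv : ∀ z x y : G, dist (z * x) (z * y) = dist x y)
    (hproper : ∀ (x : G) (R : ℝ), IsCompact (Metric.closedBall x R))
    (hgen : ∃ K : Set G, IsCompact K ∧ Subgroup.closure K = ⊤) :
    ∃ n : ℕ, ∃ f : G → (Fin n → ℝ), IsCoarseEquiv f := by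
  obtain ⟨n, a, ⟨C, hC⟩, hfin⟩ := exists_lattice hinv hproper hgen
  choose v hv using hC
  let cst : (Fin n → ℤ) → (Fin n → ℝ) := fun w i => (w i : ℝ)
  let fl : (Fin n → ℝ) → (Fin n → ℤ) := fun y i => ⌊y i⌋
  have hfl : ∀ w, fl (cst w) = w := fun w => by funext i; simp [fl, cst]
  have hflc : ∀ y, dist y (cst (fl y)) ≤ 1 := by
    intro y
    refine (dist_pi_le_iff zero_le_one).2 fun i => ?_
    rw [Real.dist_eq, abs_le]
    have h1 := Int.floor_le (y i)
    have h2 := Int.lt_floor_add_one (y i)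
    simp only [cst, fl]
    constructor <;> linarith
  -- properness of the word map
  have key : ∀ R : ℝ, ∃ S > (0 : ℝ), ∀ w w', dist (wordMap a w) (wordMap a w') ≤ R →
      dist (cst w) (cst w') ≤ S := by
    intro R
    obtain ⟨S, hS⟩ := ((hfin R).image (fun w => dist (cst w) 0)).bddAbove
    refine ⟨max S 1, lt_of_lt_of_le one_pos (le_max_right _ _), fun w w' h => ?_⟩
    rw [← li_div hinv, ← wordMap_sub] at h
    have h1 : dist (cst (w - w')) 0 ≤ S := hS ⟨_, h, rfl⟩
    have h2 : cst (w - w') = cst w - cst w' := by funext i; simp [cst]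
    rw [h2, dist_zero_right, ← dist_eq_norm] at h1
    exact h1.trans (le_max_left _ _)
  -- the word map is coarse
  have key2 : ∀ R : ℝ, ∃ S > (0 : ℝ), ∀ w w', dist (cst w) (cst w') ≤ R →
      dist (wordMap a w) (wordMap a w') ≤ S := by
    intro R
    have hF : {w : Fin n → ℤ | ∀ i, w i ∈ Set.Icc (-⌈R⌉) ⌈R⌉}.Finite :=
      Set.Finite.pi' fun i => Set.finite_Icc _ _
    obtain ⟨S, hS⟩ := (hF.image (fun w => dist (wordMap a w) 1)).bddAbove
    refine ⟨max S 1, lt_of_lt_of_le one_pos (le_max_right _ _), fun w w' h => ?_⟩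
    rw [← li_div hinv, ← wordMap_sub]
    refine le_trans (hS ⟨w - w', ?_, rfl⟩) (le_max_left _ _)
    intro i
    have h1 := (dist_le_pi_dist (cst w) (cst w') i).trans h
    rw [Real.dist_eq] at h1
    have h2 := abs_le.1 (h1.trans (Int.le_ceil R))
    simp only [cst] at h2
    refine ⟨?_, ?_⟩
    · have := h2.1
      simp only [Pi.sub_apply]
      exact_mod_cast this
    · have := h2.2
      simp only [Pi.sub_apply]
      exact_mod_cast this
  refine ⟨n, fun x => cst (v x), ?_, fun y => wordMap a (fl y), ?_, ⟨C, ?_⟩, ?_⟩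
  · intro R _
    obtain ⟨S, hS, h⟩ := key (C + R + C)
    refine ⟨S, hS, fun x x' hx => h _ _ ?_⟩
    have h1 := dist_triangle4 (wordMap a (v x)) x x' (wordMap a (v x'))
    have h2 := hv x
    rw [dist_comm] at h2
    have h3 := hv x'
    linarith
  · intro R _
    obtain ⟨S, hS, h⟩ := key2 (1 + R + 1)
    refine ⟨S, hS, fun y y' hy => h _ _ ?_⟩
    have h1 := dist_triangle4 (cst (fl y)) y y' (cst (fl y'))
    have h2 := hflc y
    rw [dist_comm] at h2
    have h3 := hflc y'
    linarith
  · intro x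
    simp only [hfl]
    exact hv x
  · obtain ⟨S, hS, h⟩ := key C
    refine ⟨1 + S, fun y => ?_⟩
    exact (dist_triangle _ _ _).trans (add_le_add (hflc y) (h _ _ (hv _)))
end
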